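/- arXiv:2602.12868 — 4 statements merged into one kernel-verified Lean document; each statement's English description precedes it below -/
import Mathlib

section
/- Let n ≥ 1 be an integer, let 1 ≤ q ≤ 2 ≤ p ≤ ∞, and set α = max{1/2 − 1/p, 1/q − 1/2} (with the convention 1/∞ = 0). Then there exists a ℂ-linear homeomorphism A from ℓ_qⁿ(ℂ) onto ℓ_pⁿ(ℂ) such that ‖A‖ · ‖A⁻¹‖ ≤ n^α, where ‖A‖ is the operator norm of A from ℓ_qⁿ(ℂ) to ℓ_pⁿ(ℂ) and ‖A⁻¹‖ is the operator norm of its inverse from ℓ_pⁿ(ℂ) to ℓ_qⁿ(ℂ). In particular, the Banach–Mazur distance between ℓ_pⁿ(ℂ) and ℓ_qⁿ(ℂ) is at most n^α. -/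
open scoped ENNReal

open Complex Complex.HadamardThreeLines in
/-- **Riesz–Thorin interpolation** between `ℓ₁` and `ℓ₂` for the bilinear form of a matrix. -/
lemma norm_sum_mul_le_of_interp {ι : Type*} [Fintype ι] (U : Matrix ι ι ℂ) {c r : ℝ}
    (hc : 0 ≤ c) (hr1 : 1 ≤ r) (hr2 : r ≤ 2) (hUc : ∀ i j, ‖U i j‖ ≤ c)
    (hU2 : ∀ x y : ι → ℂ, ‖∑ i, U.mulVec x i * y i‖ ≤
      (∑ i, ‖x i‖ ^ 2) ^ (1 / 2 : ℝ) * (∑ i, ‖y i‖ ^ 2) ^ (1 / 2 : ℝ)) (x y : ι → ℂ) :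
    ‖∑ i, U.mulVec x i * y i‖ ≤
      c ^ (2 / r - 1) * ((∑ i, ‖x i‖ ^ r) ^ (1 / r) * (∑ i, ‖y i‖ ^ r) ^ (1 / r)) := by
  have hr0 : 0 < r := by linarith
  set g : ℂ → ℂ → ℂ := fun w z => w * (‖w‖ : ℂ) ^ ((r : ℂ) * (1 - z / 2) - 1) with hg
  have hg_diff (w : ℂ) : Differentiable ℂ (g w) := by
    rcases eq_or_ne w 0 with rfl | hw
    · simp only [hg, zero_mul]
      exact differentiable_const 0
    · have : (‖w‖ : ℂ) ≠ 0 := by simpa using hw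
      intro z
      exact ((by fun_prop : DifferentiableAt ℂ (fun z : ℂ => (r : ℂ) * (1 - z / 2) - 1) z).const_cpow
        (Or.inl this)).const_mul w
  have hg_norm (w z : ℂ) (hz : z.re ≤ 1) : ‖g w z‖ = ‖w‖ ^ (r * (1 - z.re / 2)) := by
    rcases eq_or_ne w 0 with rfl | hw
    · have : r * (1 - z.re / 2) ≠ 0 := by
        apply ne_of_gt; apply mul_pos hr0; linarith
      simp [hg, Real.zero_rpow this]
    · have h : 0 < ‖w‖ := norm_pos_iff.2 hw
      rw [hg]
      simp only [norm_mul]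
      rw [norm_cpow_eq_rpow_re_of_pos h]
      have : ((r : ℂ) * (1 - z / 2) - 1).re = r * (1 - z.re / 2) - 1 := by
        simp [Complex.mul_re]
      rw [this, Real.rpow_sub_one h.ne']
      field_simp
  set f : ℂ → ℂ := fun z => ∑ i, U.mulVec (fun j => g (x j) z) i * g (y i) z with hf
  have hg_at (w : ℂ) : g w ((2 - 2 / r : ℝ) : ℂ) = w := by
    have : (r : ℂ) * (1 - ((2 - 2 / r : ℝ) : ℂ) / 2) - 1 = 0 := by
      have : (r : ℂ) ≠ 0 := by exact_mod_cast hr0.ne'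
      push_cast
      field_simp
      ring
    simp only [hg, this, cpow_zero, mul_one]
  have hf_at : f ((2 - 2 / r : ℝ) : ℂ) = ∑ i, U.mulVec x i * y i := by
    simp only [hf, hg_at]
  have hf_diff : Differentiable ℂ f := by
    simp only [hf, Matrix.mulVec, dotProduct]
    fun_prop
  set X := ∑ i, ‖x i‖ ^ r
  set Y := ∑ i, ‖y i‖ ^ r
  have hX : 0 ≤ X := Finset.sum_nonneg fun i _ => by positivity
  have hY : 0 ≤ Y := Finset.sum_nonneg fun i _ => by positivity
  have hf_le (z : ℂ) : ‖f z‖ ≤ c * ((∑ i, ‖g (x i) z‖) * ∑ i, ‖g (y i) z‖) := by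
    calc ‖f z‖ ≤ ∑ i, (∑ j, c * ‖g (x j) z‖) * ‖g (y i) z‖ := by
          refine (norm_sum_le _ _).trans (Finset.sum_le_sum fun i _ => ?_)
          rw [norm_mul]
          gcongr
          refine (norm_sum_le _ _).trans (Finset.sum_le_sum fun j _ => ?_)
          rw [norm_mul]
          gcongr
          exact hUc i j
      _ = _ := by rw [← Finset.mul_sum, ← Finset.mul_sum, mul_assoc]
  have hg_bdd (w z : ℂ) (h0 : 0 ≤ z.re) (h1 : z.re ≤ 1) : ‖g w z‖ ≤ (1 + ‖w‖) ^ r := by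
    rw [hg_norm w z h1]
    calc ‖w‖ ^ (r * (1 - z.re / 2)) ≤ (1 + ‖w‖) ^ (r * (1 - z.re / 2)) := by
          apply Real.rpow_le_rpow (norm_nonneg _) (by linarith)
          apply mul_nonneg hr0.le; linarith
      _ ≤ _ := by
          apply Real.rpow_le_rpow_of_exponent_le
          · linarith [norm_nonneg w]
          · nlinarith
  have h01 : 0 ≤ 2 - 2 / r ∧ 2 - 2 / r ≤ 1 := by
    constructor
    · rw [sub_nonneg, div_le_iff₀ hr0]; linarith
    · have : 1 ≤ 2 / r := by rw [le_div_iff₀ hr0]; linarith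
      linarith
  have key := norm_le_interp_of_mem_verticalClosedStrip₀₁' f (z := ((2 - 2 / r : ℝ) : ℂ))
    (a := c * (X * Y)) (b := X ^ (1 / 2 : ℝ) * Y ^ (1 / 2 : ℝ)) ?_ hf_diff.diffContOnCl ?_ ?_ ?_
  · rw [hf_at, ofReal_re] at key
    refine key.trans_eq ?_
    rw [Real.mul_rpow hc (by positivity), ← Real.mul_rpow hX hY, ← Real.mul_rpow hX hY,
      ← Real.rpow_mul (by positivity), mul_assoc,
      ← Real.rpow_add_of_nonneg (by positivity) (by linarith) (by linarith)]
    congr 2 <;> ring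
  · simpa [verticalClosedStrip] using h01
  · refine ⟨c * ((∑ i, (1 + ‖x i‖) ^ r) * ∑ i, (1 + ‖y i‖) ^ r), ?_⟩
    rintro _ ⟨z, hz, rfl⟩
    simp only [verticalClosedStrip, Set.mem_preimage, Set.mem_Icc] at hz
    refine (hf_le z).trans ?_
    gcongr with i _ i _
    · exact hg_bdd _ _ hz.1 hz.2
    · exact hg_bdd _ _ hz.1 hz.2
  · intro z hz
    have hz : z.re = 0 := by simpa using hz
    refine (hf_le z).trans_eq ?_
    have (w : ℂ) : ‖g w z‖ = ‖w‖ ^ r := by rw [hg_norm _ _ (by linarith), hz]; simp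
    simp only [this, X, Y]
  · intro z hz
    have hz : z.re = 1 := by simpa using hz
    refine (hU2 _ _).trans_eq ?_
    have (w : ℂ) : ‖g w z‖ ^ 2 = ‖w‖ ^ r := by
      rw [hg_norm _ _ hz.le, hz, ← Real.rpow_natCast, ← Real.rpow_mul (norm_nonneg _)]
      congr 1
      push_cast
      ring
    simp only [this, X, Y]

lemma sum_norm_sq_mulVec_of_unitary {ι : Type*} [Fintype ι] [DecidableEq ι] {U : Matrix ι ι ℂ}
    (hU : U.conjTranspose * U = 1) (x : ι → ℂ) :
    ∑ i, ‖U.mulVec x i‖ ^ 2 = ∑ i, ‖x i‖ ^ 2 := by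
  have h (v : ι → ℂ) : ((∑ i, ‖v i‖ ^ 2 : ℝ) : ℂ) = star v ⬝ᵥ v := by
    simp [dotProduct, Complex.conj_mul']
  rw [← Complex.ofReal_inj, h, h, Matrix.star_mulVec, ← Matrix.dotProduct_mulVec,
    Matrix.mulVec_mulVec, hU, Matrix.one_mulVec]

lemma norm_sum_mulVec_mul_le_of_unitary {ι : Type*} [Fintype ι] [DecidableEq ι]
    {U : Matrix ι ι ℂ} (hU : U.conjTranspose * U = 1) (x y : ι → ℂ) :
    ‖∑ i, U.mulVec x i * y i‖ ≤
      (∑ i, ‖x i‖ ^ 2) ^ (1 / 2 : ℝ) * (∑ i, ‖y i‖ ^ 2) ^ (1 / 2 : ℝ) := by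
  rw [← sum_norm_sq_mulVec_of_unitary hU x, ← Real.sqrt_eq_rpow, ← Real.sqrt_eq_rpow]
  refine (norm_sum_le _ _).trans ?_
  simp only [norm_mul]
  exact Real.sum_mul_le_sqrt_mul_sqrt _ _ _

/-- A unitary matrix all of whose entries have modulus `n ^ (-1/2)` (discrete Fourier). -/
lemma exists_unitary_flat (n : ℕ) (hn : 1 ≤ n) : ∃ U : Matrix (Fin n) (Fin n) ℂ,
    U.conjTranspose * U = 1 ∧ ∀ i j, ‖U i j‖ = (n : ℝ) ^ (-(1 / 2) : ℝ) := by
  have : NeZero n := ⟨by omega⟩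
  let e : Fin n ≃ ZMod n := Fintype.equivOfCardEq (by simp [ZMod.card])
  let c : ℝ := (n : ℝ) ^ (-(1 / 2) : ℝ)
  have hc : (c : ℂ) * c * n = 1 := by
    have hn' : (0 : ℝ) < n := by exact_mod_cast hn
    have : c * c * n = 1 := by
      simp only [c]
      rw [← Real.rpow_add hn', ← Real.rpow_add_one hn'.ne']
      norm_num
    exact_mod_cast this
  refine ⟨Matrix.of fun i j => c * ZMod.stdAddChar (e i * e j), ?_, fun i j => ?_⟩
  · ext i j
    have h (k : Fin n) : star ((c : ℂ) * ZMod.stdAddChar (e k * e i)) *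
        (c * ZMod.stdAddChar (e k * e j)) = c * c * ZMod.stdAddChar (e k * (e j - e i)) := by
      rw [mul_sub, sub_eq_add_neg, AddChar.map_add_eq_mul, AddChar.map_neg_eq_inv]
      have : star (ZMod.stdAddChar (e k * e i)) = (ZMod.stdAddChar (e k * e i))⁻¹ := by
        rw [ZMod.stdAddChar_apply, ← Circle.coe_inv, Circle.coe_inv_eq_conj]; rfl
      rw [star_mul', this]
      simp
      ring
    simp only [Matrix.mul_apply, Matrix.conjTranspose_apply, Matrix.of_apply, h]
    rw [← Finset.mul_sum, Equiv.sum_comp e (fun k => ZMod.stdAddChar (k * (e j - e i))),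
      AddChar.sum_mulShift _ (ZMod.isPrimitive_stdAddChar n), Matrix.one_apply]
    by_cases hij : i = j
    · subst hij; simpa [ZMod.card] using hc
    · have : e j - e i ≠ 0 := by
        rw [sub_ne_zero]; exact fun h => hij (e.injective h).symm
      simp [this, hij]
  · rw [Matrix.of_apply, norm_mul, ZMod.stdAddChar_apply, Circle.norm_coe, mul_one, Complex.norm_real,
      Real.norm_of_nonneg (by positivity)]

lemma PiLp.norm_toLp_anti {ι : Type*} [Fintype ι] {r s : ℝ≥0∞} [Fact (1 ≤ r)] [Fact (1 ≤ s)]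
    (hrs : r ≤ s) (x : ι → ℂ) :
    ‖(WithLp.toLp s x : PiLp s fun _ : ι => ℂ)‖ ≤ ‖(WithLp.toLp r x : PiLp r fun _ : ι => ℂ)‖ := by
  have h_apply (i : ι) : ‖x i‖ ≤ ‖(WithLp.toLp r x : PiLp r fun _ : ι => ℂ)‖ :=
    PiLp.norm_apply_le (WithLp.toLp r x : PiLp r fun _ : ι => ℂ) i
  rcases eq_or_ne s ∞ with rfl | hs
  · rw [PiLp.norm_eq_ciSup]
    exact Real.iSup_le h_apply (norm_nonneg _)
  have hr : r ≠ ∞ := ne_top_of_le_ne_top hs hrs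
  have hr0 : 0 < r.toReal := ENNReal.toReal_pos (zero_lt_one.trans_le Fact.out).ne' hr
  have hrs' : r.toReal ≤ s.toReal := ENNReal.toReal_mono hs hrs
  have hs0 : 0 < s.toReal := hr0.trans_le hrs'
  set M := ‖(WithLp.toLp r x : PiLp r fun _ : ι => ℂ)‖ with hM
  have hM0 : 0 ≤ M := norm_nonneg _
  have hMr : M ^ r.toReal = ∑ i, ‖x i‖ ^ r.toReal := by
    rw [hM, PiLp.norm_eq_sum hr0, ← Real.rpow_mul (Finset.sum_nonneg fun i _ => by positivity)]
    simp [hr0.ne']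
  rw [PiLp.norm_eq_sum hs0, one_div, Real.rpow_inv_le_iff_of_pos
    (Finset.sum_nonneg fun i _ => by positivity) hM0 hs0]
  calc ∑ i, ‖x i‖ ^ s.toReal ≤ ∑ i, ‖x i‖ ^ r.toReal * M ^ (s.toReal - r.toReal) := by
        refine Finset.sum_le_sum fun i _ => ?_
        have : s.toReal = r.toReal + (s.toReal - r.toReal) := by ring
        conv_lhs => rw [this, Real.rpow_add_of_nonneg (norm_nonneg _) hr0.le (by linarith)]
        gcongr
        exact h_apply i
    _ = M ^ s.toReal := by
        rw [← Finset.sum_mul, ← hMr, ← Real.rpow_add_of_nonneg hM0 hr0.le (by linarith)]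
        congr 1
        ring

lemma PiLp.norm_toLp_le_card_rpow_mul {ι : Type*} [Fintype ι] {r s : ℝ≥0∞}
    [Fact (1 ≤ r)] [Fact (1 ≤ s)] (hrs : r ≤ s) (x : ι → ℂ) :
    ‖(WithLp.toLp r x : PiLp r fun _ : ι => ℂ)‖ ≤
      (Fintype.card ι : ℝ) ^ (r⁻¹.toReal - s⁻¹.toReal) *
        ‖(WithLp.toLp s x : PiLp s fun _ : ι => ℂ)‖ := by
  rcases eq_or_ne r ∞ with rfl | hr
  · obtain rfl : s = ∞ := top_le_iff.1 hrs
    simp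
  have hr0 : 0 < r.toReal := ENNReal.toReal_pos (zero_lt_one.trans_le Fact.out).ne' hr
  have hsum : 0 ≤ ∑ i, ‖x i‖ ^ r.toReal := Finset.sum_nonneg fun i _ => by positivity
  rw [PiLp.norm_eq_sum hr0, one_div, Real.rpow_inv_le_iff_of_pos hsum (by positivity) hr0]
  rw [Real.mul_rpow (by positivity) (norm_nonneg _), ← Real.rpow_mul (by positivity), sub_mul,
    ENNReal.toReal_inv, inv_mul_cancel₀ hr0.ne']
  rcases eq_or_ne s ∞ with rfl | hs
  · calc ∑ i, ‖x i‖ ^ r.toReal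
        ≤ ∑ _i : ι, ‖(WithLp.toLp ∞ x : PiLp ∞ fun _ : ι => ℂ)‖ ^ r.toReal := by
          gcongr with i _
          exact PiLp.norm_apply_le (WithLp.toLp ∞ x : PiLp ∞ fun _ : ι => ℂ) i
      _ = _ := by simp
  have hrs' : r.toReal ≤ s.toReal := ENNReal.toReal_mono hs hrs
  have hs0 : 0 < s.toReal := hr0.trans_le hrs'
  have hsum' : 0 ≤ ∑ i, ‖x i‖ ^ s.toReal := Finset.sum_nonneg fun i _ => by positivity
  have h := Real.rpow_sum_le_const_mul_sum_rpow_of_nonneg (s := Finset.univ)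
    (f := fun i => ‖x i‖ ^ r.toReal) ((one_le_div hr0).2 hrs') (fun i _ => by positivity)
  simp only [← Real.rpow_mul (norm_nonneg _), mul_div_cancel₀ _ hr0.ne', Finset.card_univ] at h
  have h' := Real.rpow_le_rpow (by positivity) h (by positivity : 0 ≤ r.toReal / s.toReal)
  rw [Real.mul_rpow (by positivity) hsum', ← Real.rpow_mul hsum, ← Real.rpow_mul (by positivity)]
    at h'
  rw [PiLp.norm_eq_sum hs0, ← Real.rpow_mul hsum', ENNReal.toReal_inv]
  convert h' using 2
  · field_simp
    simp
  · congr 1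
    field_simp
  · congr 1
    ring

/-- **Hausdorff–Young inequality** for a unitary matrix with entries bounded by `c`. -/
lemma PiLp.norm_toLp_mulVec_le {ι : Type*} [Fintype ι] [DecidableEq ι] {U : Matrix ι ι ℂ}
    (hU : U.conjTranspose * U = 1) {c : ℝ} (hc : 0 ≤ c) (hUc : ∀ i j, ‖U i j‖ ≤ c)
    {r s : ℝ≥0∞} [Fact (1 ≤ r)] [Fact (1 ≤ s)] (hr2 : r ≤ 2) (hrs : r⁻¹ + s⁻¹ = 1) (x : ι → ℂ) :
    ‖(WithLp.toLp s (U.mulVec x) : PiLp s fun _ : ι => ℂ)‖ ≤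
      c ^ (2 * r⁻¹.toReal - 1) * ‖(WithLp.toLp r x : PiLp r fun _ : ι => ℂ)‖ := by
  rcases eq_or_ne s ∞ with rfl | hs
  · obtain rfl : r = 1 := by simpa using hrs
    rw [PiLp.norm_eq_ciSup]
    refine Real.iSup_le (fun i => ?_) (by positivity)
    norm_num [PiLp.norm_eq_of_L1, Finset.mul_sum]
    refine (norm_sum_le _ _).trans (Finset.sum_le_sum fun j _ => ?_)
    rw [norm_mul]
    gcongr
    exact hUc i j
  have hr : r ≠ ∞ := ne_top_of_le_ne_top (by simp) hr2
  have hr1 : 1 ≤ r.toReal := by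
    simpa using ENNReal.toReal_mono hr (Fact.out : 1 ≤ r)
  have hr2' : r.toReal ≤ 2 := by simpa using ENNReal.toReal_mono (by simp) hr2
  have hs1 : 1 ≤ s.toReal := by
    simpa using ENNReal.toReal_mono hs (Fact.out : 1 ≤ s)
  have hr0 : 0 < r.toReal := by linarith
  have hs0 : 0 < s.toReal := by linarith
  have hrs' : r.toReal⁻¹ + s.toReal⁻¹ = 1 := by
    have := congrArg ENNReal.toReal hrs
    rwa [ENNReal.toReal_add, ENNReal.toReal_inv, ENNReal.toReal_inv, ENNReal.toReal_one] at this
    · exact ENNReal.inv_ne_top.2 (zero_lt_one.trans_le Fact.out).ne'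
    · exact ENNReal.inv_ne_top.2 (zero_lt_one.trans_le Fact.out).ne'
  have hs2 : 1 + (s.toReal - 2) ≠ 0 := by
    intro h
    have hs1' : s.toReal = 1 := by linarith
    rw [hs1', inv_one] at hrs'
    have := inv_pos.2 hr0
    linarith
  set w := U.mulVec x with hw
  let y : ι → ℂ := fun i => star (w i) * ((‖w i‖ ^ (s.toReal - 2) : ℝ) : ℂ)
  set S := ∑ i, ‖w i‖ ^ s.toReal with hS
  have hS0 : 0 ≤ S := Finset.sum_nonneg fun i _ => by positivity
  have h := norm_sum_mul_le_of_interp U hc hr1 hr2' hUc (norm_sum_mulVec_mul_le_of_unitary hU) x y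
  have hwy : ∑ i, w i * y i = (S : ℂ) := by
    rw [hS, Complex.ofReal_sum]
    refine Finset.sum_congr rfl fun i _ => ?_
    rcases eq_or_ne (w i) 0 with h0 | h0
    · simp [h0, Real.zero_rpow hs0.ne']
    · have : 0 < ‖w i‖ := norm_pos_iff.2 h0
      simp only [y]
      rw [← mul_assoc, Complex.star_def, Complex.mul_conj', ← Complex.ofReal_pow,
        ← Complex.ofReal_mul, ← Real.rpow_natCast, ← Real.rpow_add this]
      congr 2
      push_cast
      ring
  have hy : ∑ i, ‖y i‖ ^ r.toReal = S := by
    refine Finset.sum_congr rfl fun i _ => ?_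
    rcases eq_or_ne (w i) 0 with h0 | h0
    · simp [y, h0, Real.zero_rpow hs0.ne', Real.zero_rpow hr0.ne']
    · have : 0 < ‖w i‖ := norm_pos_iff.2 h0
      simp only [y]
      rw [norm_mul, norm_star, Complex.norm_real, Real.norm_of_nonneg (by positivity),
        ← Real.rpow_one_add' (by positivity) hs2, ← Real.rpow_mul this.le]
      congr 1
      field_simp at hrs'
      linarith
  rw [← hw, hwy, hy, Complex.norm_real, Real.norm_of_nonneg hS0] at h
  rw [PiLp.norm_eq_sum hs0, PiLp.norm_eq_sum hr0, ENNReal.toReal_inv]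
  change S ^ (1 / s.toReal) ≤ _ * (∑ i, ‖x i‖ ^ r.toReal) ^ (1 / r.toReal)
  have hX : 0 ≤ ∑ i, ‖x i‖ ^ r.toReal := Finset.sum_nonneg fun i _ => by positivity
  rcases hS0.eq_or_lt with h0 | h0
  · rw [← h0, Real.zero_rpow (by positivity)]
    positivity
  · rw [← mul_assoc] at h
    have : S = S ^ (1 / s.toReal) * S ^ (1 / r.toReal) := by
      rw [← Real.rpow_add h0, one_div, one_div, add_comm, hrs', Real.rpow_one]
    conv_lhs at h => rw [this]
    exact le_of_mul_le_mul_right h (by positivity)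

/-- The operator `ℓ_q → ℓ_p` with matrix `U`, for `U` unitary. -/
noncomputable def Matrix.toPiLpEquiv {ι : Type*} [Fintype ι] [DecidableEq ι] (U : Matrix ι ι ℂ)
    (hU : U.conjTranspose * U = 1) (q p : ℝ≥0∞) [Fact (1 ≤ q)] [Fact (1 ≤ p)] :
    PiLp q (fun _ : ι => ℂ) ≃L[ℂ] PiLp p (fun _ : ι => ℂ) :=
  (((WithLp.linearEquiv q ℂ (ι → ℂ)).trans
    (Matrix.toLin'OfInv hU (mul_eq_one_comm.1 hU))).trans
      (WithLp.linearEquiv p ℂ (ι → ℂ)).symm).toContinuousLinearEquiv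

@[simp]
lemma Matrix.toPiLpEquiv_apply {ι : Type*} [Fintype ι] [DecidableEq ι] (U : Matrix ι ι ℂ)
    (hU : U.conjTranspose * U = 1) (q p : ℝ≥0∞) [Fact (1 ≤ q)] [Fact (1 ≤ p)]
    (x : PiLp q fun _ : ι => ℂ) :
    U.toPiLpEquiv hU q p x = WithLp.toLp p (U.mulVec (WithLp.ofLp x)) := by
  simp [Matrix.toPiLpEquiv, Matrix.toLin'OfInv]

@[simp]
lemma Matrix.toPiLpEquiv_symm_apply {ι : Type*} [Fintype ι] [DecidableEq ι] (U : Matrix ι ι ℂ)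
    (hU : U.conjTranspose * U = 1) (q p : ℝ≥0∞) [Fact (1 ≤ q)] [Fact (1 ≤ p)]
    (y : PiLp p fun _ : ι => ℂ) :
    (U.toPiLpEquiv hU q p).symm y = WithLp.toLp q (U.conjTranspose.mulVec (WithLp.ofLp y)) := by
  rw [ContinuousLinearEquiv.symm_apply_eq]
  simp [Matrix.mulVec_mulVec, mul_eq_one_comm.1 hU]

/-- For `1 ≤ q ≤ 2 ≤ p ≤ ∞` and `α = max (1/2 - 1/p) (1/q - 1/2)`, there is a ℂ-linear
homeomorphism `A : ℓ_qⁿ(ℂ) → ℓ_pⁿ(ℂ)` with `‖A‖ ⬝ ‖A⁻¹‖ ≤ n ^ α`; in particular the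
Banach–Mazur distance between `ℓ_pⁿ(ℂ)` and `ℓ_qⁿ(ℂ)` is at most `n ^ α`. -/
theorem stmt_4 (n : ℕ) (hn : 1 ≤ n) (p q : ℝ≥0∞) (hq1 : 1 ≤ q) (hq2 : q ≤ 2) (hp : 2 ≤ p) :
    letI : Fact (1 ≤ q) := ⟨hq1⟩
    letI : Fact (1 ≤ p) := ⟨le_trans (by norm_num) hp⟩
    ∃ A : PiLp q (fun _ : Fin n => ℂ) ≃L[ℂ] PiLp p (fun _ : Fin n => ℂ),
      ‖(A : PiLp q (fun _ : Fin n => ℂ) →L[ℂ] PiLp p (fun _ : Fin n => ℂ))‖ *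
        ‖(A.symm : PiLp p (fun _ : Fin n => ℂ) →L[ℂ] PiLp q (fun _ : Fin n => ℂ))‖ ≤
        (n : ℝ) ^ max (1 / 2 - (1 / p).toReal) ((1 / q).toReal - 1 / 2) := by
  have : Fact (1 ≤ q) := ⟨hq1⟩
  have : Fact (1 ≤ p) := ⟨le_trans (by norm_num) hp⟩
  obtain ⟨U, hU, hUc⟩ := exists_unitary_flat n hn
  have hn1 : (1 : ℝ) ≤ n := by exact_mod_cast hn
  have hn0 : (0 : ℝ) < n := by linarith
  have hUU : U.conjTranspose.conjTranspose * U.conjTranspose = 1 := by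
    rw [Matrix.conjTranspose_conjTranspose]; exact mul_eq_one_comm.1 hU
  refine ⟨U.toPiLpEquiv hU q p, ?_⟩
  set a := p⁻¹.toReal with ha
  set b := q⁻¹.toReal with hb
  rw [one_div p, one_div q, ← ha, ← hb]
  have h2 : ((2 : ℝ≥0∞)⁻¹).toReal = 1 / 2 := by simp
  have hp1 : p⁻¹ ≤ 1 := ENNReal.inv_le_one.2 (le_trans (by norm_num) hp)
  have hq1' : q⁻¹ ≤ 1 := ENNReal.inv_le_one.2 hq1
  have hc (t : ℝ) : ((n : ℝ) ^ (-(1 / 2) : ℝ)) ^ (2 * t - 1) = (n : ℝ) ^ (1 / 2 - t) := by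
    rw [← Real.rpow_mul hn0.le]
    congr 1
    ring
  have hsymm : ‖((U.toPiLpEquiv hU q p).symm :
      PiLp p (fun _ : Fin n => ℂ) →L[ℂ] PiLp q (fun _ : Fin n => ℂ))‖ ≤ (n : ℝ) ^ (b - a) := by
    refine ContinuousLinearMap.opNorm_le_bound _ (by positivity) fun y => ?_
    have h1 := PiLp.norm_toLp_le_card_rpow_mul hq2 (U.conjTranspose.mulVec (WithLp.ofLp y))
    have h3 := PiLp.norm_toLp_le_card_rpow_mul hp (WithLp.ofLp y)
    have h4 : ‖(WithLp.toLp 2 (U.conjTranspose.mulVec (WithLp.ofLp y)) :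
        PiLp 2 fun _ : Fin n => ℂ)‖ = ‖(WithLp.toLp 2 (WithLp.ofLp y) :
        PiLp 2 fun _ : Fin n => ℂ)‖ := by
      rw [EuclideanSpace.norm_eq, EuclideanSpace.norm_eq]
      exact congrArg _ (sum_norm_sq_mulVec_of_unitary hUU _)
    rw [h2, Fintype.card_fin] at h1 h3
    rw [h4] at h1
    rw [ContinuousLinearEquiv.coe_coe, Matrix.toPiLpEquiv_symm_apply]
    refine h1.trans ((mul_le_mul_of_nonneg_left h3 (by positivity)).trans_eq ?_)
    rw [← mul_assoc, ← Real.rpow_add hn0, ← ha, ← hb, sub_add_sub_cancel]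
  have hmain : ∃ t, (t = 1 / 2 - a ∨ t = b - 1 / 2) ∧ ‖(U.toPiLpEquiv hU q p :
      PiLp q (fun _ : Fin n => ℂ) →L[ℂ] PiLp p (fun _ : Fin n => ℂ))‖ ≤ (n : ℝ) ^ (-t) := by
    rcases le_total 1 (p⁻¹ + q⁻¹) with h | h
    · refine ⟨1 / 2 - a, Or.inl rfl, ContinuousLinearMap.opNorm_le_bound _ (by positivity)
        fun x => ?_⟩
      have : Fact (1 ≤ (1 - p⁻¹)⁻¹) := ⟨ENNReal.one_le_inv.2 tsub_le_self⟩
      have hr2 : (1 - p⁻¹)⁻¹ ≤ 2 := by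
        rw [ENNReal.inv_le_iff_inv_le, ← ENNReal.one_sub_inv_two]
        exact tsub_le_tsub_left (ENNReal.inv_le_inv.2 hp) _
      have hqr : q ≤ (1 - p⁻¹)⁻¹ := by
        rw [ENNReal.le_inv_iff_le_inv]
        exact tsub_le_iff_left.2 h
      have h1 := PiLp.norm_toLp_mulVec_le hU (by positivity) (fun i j => (hUc i j).le) hr2
        (s := p) (by rw [inv_inv, tsub_add_cancel_of_le hp1]) (WithLp.ofLp x)
      have h3 := PiLp.norm_toLp_anti hqr (WithLp.ofLp x)
      rw [hc, inv_inv, ENNReal.toReal_sub_of_le hp1 (by simp), ENNReal.toReal_one, ← ha] at h1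
      rw [ContinuousLinearEquiv.coe_coe, Matrix.toPiLpEquiv_apply,
        (by ring : -(1 / 2 - a) = 1 / 2 - (1 - a))]
      exact h1.trans (mul_le_mul_of_nonneg_left h3 (by positivity))
    · refine ⟨b - 1 / 2, Or.inr rfl, ContinuousLinearMap.opNorm_le_bound _ (by positivity)
        fun x => ?_⟩
      have : Fact (1 ≤ (1 - q⁻¹)⁻¹) := ⟨ENNReal.one_le_inv.2 tsub_le_self⟩
      have hsp : (1 - q⁻¹)⁻¹ ≤ p := by
        rw [ENNReal.inv_le_iff_inv_le]
        exact ENNReal.le_sub_of_add_le_right (ne_top_of_le_ne_top (by simp) hq1') h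
      have h1 := PiLp.norm_toLp_mulVec_le hU (by positivity) (fun i j => (hUc i j).le) hq2
        (s := (1 - q⁻¹)⁻¹) (by rw [inv_inv, add_tsub_cancel_of_le hq1']) (WithLp.ofLp x)
      have h3 := PiLp.norm_toLp_anti hsp (U.mulVec (WithLp.ofLp x))
      rw [hc, ← hb] at h1
      rw [ContinuousLinearEquiv.coe_coe, Matrix.toPiLpEquiv_apply, neg_sub]
      exact h3.trans h1
  obtain ⟨t, ht, hA⟩ := hmain
  calc _ ≤ (n : ℝ) ^ (-t) * (n : ℝ) ^ (b - a) :=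
        mul_le_mul hA hsymm (norm_nonneg _) (by positivity)
    _ = (n : ℝ) ^ (-t + (b - a)) := (Real.rpow_add hn0 _ _).symm
    _ ≤ _ := by
      refine Real.rpow_le_rpow_of_exponent_le hn1 ?_
      rcases ht with rfl | rfl
      · exact le_max_of_le_right (by linarith)
      · exact le_max_of_le_left (by linarith)
end

section
/- For every ℂ-linear homeomorphism A from ℓ₁³(ℂ) onto ℓ_∞³(ℂ), one has ‖A‖ · ‖A⁻¹‖ ≥ √3, where ‖A‖ is the operator norm of A from ℓ₁³(ℂ) to ℓ_∞³(ℂ) and ‖A⁻¹‖ is the operator norm of its inverse from ℓ_∞³(ℂ) to ℓ₁³(ℂ). In particular, the Banach–Mazur distance between ℓ₁³(ℂ) and ℓ_∞³(ℂ) is at least √3. -/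
open scoped ENNReal

namespace CubeRoot

section

open Complex

/-- The primitive cube root of unity with positive imaginary part. -/
noncomputable def omega : ℂ := ⟨-1 / 2, √3 / 2⟩

theorem omega_sq : omega ^ 2 = ⟨-1 / 2, -(√3 / 2)⟩ := by
  have h : √3 ^ 2 = 3 := Real.sq_sqrt (by norm_num)
  apply Complex.ext <;> simp [omega, pow_two] <;> nlinarith

theorem omega_pow_three : omega ^ 3 = 1 := by
  have h : √3 ^ 2 = 3 := Real.sq_sqrt (by norm_num)
  rw [pow_succ, omega_sq]
  apply Complex.ext <;> simp [omega] <;> nlinarith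

theorem normSq_omega : normSq omega = 1 := by
  have h : √3 ^ 2 = 3 := Real.sq_sqrt (by norm_num)
  simp only [normSq_apply, omega]
  nlinarith

theorem exists_normSq_one_mul_eq_norm (z : ℂ) : ∃ u : ℂ, normSq u = 1 ∧ u * z = (‖z‖ : ℂ) := by
  rcases eq_or_ne z 0 with rfl | hz
  · exact ⟨1, by simp, by simp⟩
  · have hz' : (‖z‖ : ℂ) ≠ 0 := by simpa using hz
    refine ⟨(starRingEnd ℂ) z / ‖z‖, ?_, ?_⟩
    · rw [normSq_div, normSq_conj, normSq_ofReal, normSq_eq_norm_sq, ← pow_two,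
        div_self (by simpa using hz)]
    · rw [div_mul_eq_mul_div, conj_mul', pow_two, mul_div_cancel_right₀ _ hz']

theorem bound_of_two {h k q x y : ℝ} (hh : 0 ≤ h) (hk : 0 < k) (hhk : h ^ 2 + k ^ 2 = 1)
    (hq : 0 < q) (hq3 : q ^ 2 = 3) (hy : 0 ≤ y) (hxy : x ^ 2 + y ^ 2 ≤ 1)
    (H : 1 < (x - q * h) ^ 2 + (y - h) ^ 2) : x < q * h - k ∨ x < (q * h - k) / 2 := by
  have key : 0 < h * (2 * h - q * x - y) := by nlinarith
  have lin : q * x + y < 2 * h := by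
    have := pos_of_mul_pos_right key hh
    linarith
  have hpos : 0 < h := hh.lt_of_ne (by rintro rfl; simp at key)
  rcases le_or_gt y (2 * h) with h1 | h1
  · left
    by_contra! hc
    have h2 : k ^ 2 < (x - q * h) ^ 2 := by nlinarith [mul_nonneg hy (sub_nonneg.2 h1)]
    have h3 : k < x - q * h := by
      by_contra! h3
      nlinarith
    have := mul_pos hq hk
    nlinarith
  · right
    by_contra! hc
    have hx : x < 0 := by nlinarith
    have hx2 : (q * h - k) / 2 < 0 := by linarith
    have hkq : h < q * k := by nlinarith
    have h2 : (q * h - x) ^ 2 ≤ ((k + q * h) / 2) ^ 2 := by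
      apply pow_le_pow_left₀ <;> nlinarith
    have h3 : ((q * k - h) / 2) ^ 2 < (y - h) ^ 2 := by nlinarith
    have h4 : (q * k - h) / 2 < y - h := lt_of_pow_lt_pow_left₀ 2 (by linarith) h3
    nlinarith

theorem two_pairs_aux {h k q a₁ a₂ b₁ b₂ : ℝ} (hh : 0 ≤ h) (hk : 1 / 2 ≤ k)
    (hhk : h ^ 2 + k ^ 2 = 1) (hq : 0 < q) (hq3 : q ^ 2 = 3)
    (ha : a₁ ^ 2 + a₂ ^ 2 ≤ 1) (hb : b₁ ^ 2 + b₂ ^ 2 ≤ 1)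
    (Ha : 1 < (a₁ - q * h) ^ 2 + (a₂ - h) ^ 2) (Ha' : 1 < (a₁ - q * h) ^ 2 + (a₂ + h) ^ 2)
    (Hb : 1 < (b₁ - q * h) ^ 2 + (b₂ - h) ^ 2) (Hb' : 1 < (b₁ - q * h) ^ 2 + (b₂ + h) ^ 2) :
    1 < 2 * q * h - a₁ - b₁ := by
  have key : ∀ x y : ℝ, x ^ 2 + y ^ 2 ≤ 1 → 1 < (x - q * h) ^ 2 + (y - h) ^ 2 →
      1 < (x - q * h) ^ 2 + (y + h) ^ 2 → x < q * h - k ∨ x < (q * h - k) / 2 := by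
    intro x y h1 h2 h3
    rcases le_total 0 y with hy | hy
    · exact bound_of_two hh (by linarith) hhk hq hq3 hy h1 h2
    · exact bound_of_two (y := -y) hh (by linarith) hhk hq hq3 (by linarith) (by nlinarith)
        (by nlinarith)
  have h1 : 1 ≤ q * h + k := by
    have h2 : 0 ≤ q * h := by positivity
    have h3 : 1 ≤ (q * h + k) ^ 2 := by nlinarith [sq_nonneg h, mul_nonneg h2 (by linarith : 0 ≤ k)]
    nlinarith
  rcases key _ _ ha Ha Ha' with h2 | h2 <;> rcases key _ _ hb Hb Hb' with h3 | h3 <;> linarith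

theorem normSq_add_omega_mul {a b : ℂ} {h : ℝ} (hab : a + b = (2 * √3 * h : ℝ)) :
    normSq (a + omega * b) = 3 * ((a.re - √3 * h) ^ 2 + (a.im + h) ^ 2) := by
  have hq : √3 ^ 2 = 3 := Real.sq_sqrt (by norm_num)
  obtain rfl : b = (2 * √3 * h : ℝ) - a := by rw [← hab]; ring
  simp only [normSq_apply, omega, add_re, add_im, mul_re, mul_im, sub_re, sub_im, ofReal_re,
    ofReal_im]
  grind

theorem normSq_add_omega_sq_mul {a b : ℂ} {h : ℝ} (hab : a + b = (2 * √3 * h : ℝ)) :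
    normSq (a + omega ^ 2 * b) = 3 * ((a.re - √3 * h) ^ 2 + (a.im - h) ^ 2) := by
  have hq : √3 ^ 2 = 3 := Real.sq_sqrt (by norm_num)
  obtain rfl : b = (2 * √3 * h : ℝ) - a := by rw [← hab]; ring
  simp only [normSq_apply, omega_sq, add_re, add_im, mul_re, mul_im, sub_re, sub_im, ofReal_re,
    ofReal_im]
  grind

theorem not_two_pairs_of_real {a b c : ℂ} {h : ℝ} (ha : normSq a ≤ 1) (hb : normSq b ≤ 1)
    (hc : normSq c ≤ 1) (hh : 0 ≤ h) (habc : a + b + c = (2 * √3 * h : ℝ))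
    (h₁ : 3 < normSq (a + omega * (b + c))) (h₂ : 3 < normSq (a + omega ^ 2 * (b + c)))
    (h₃ : 3 < normSq (b + omega * (a + c))) (h₄ : 3 < normSq (b + omega ^ 2 * (a + c))) :
    False := by
  have hq : √3 ^ 2 = 3 := Real.sq_sqrt (by norm_num)
  have hq0 : 0 < √3 := by positivity
  have e₁ : a + (b + c) = (2 * √3 * h : ℝ) := by rw [← habc]; ring
  have e₂ : b + (a + c) = (2 * √3 * h : ℝ) := by rw [← habc]; ring
  rw [normSq_add_omega_mul e₁] at h₁
  rw [normSq_add_omega_sq_mul e₁] at h₂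
  rw [normSq_add_omega_mul e₂] at h₃
  rw [normSq_add_omega_sq_mul e₂] at h₄
  have hre := congrArg re habc
  simp only [add_re, ofReal_re] at hre
  rw [normSq_apply] at ha hb hc
  have a1 : a.re ≤ 1 := by nlinarith
  have b1 : b.re ≤ 1 := by nlinarith
  have c1 : c.re ≤ 1 := by nlinarith
  have hh2 : h ^ 2 ≤ 3 / 4 := by nlinarith [mul_nonneg hq0.le hh]
  have hk := Real.sq_sqrt (by linarith : 0 ≤ 1 - h ^ 2)
  have hk2 : 1 / 2 ≤ √(1 - h ^ 2) := Real.le_sqrt_of_sq_le (by linarith)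
  have := two_pairs_aux hh hk2 (by linarith) hq0 hq (a₁ := a.re) (a₂ := a.im) (b₁ := b.re)
    (b₂ := b.im) (by linarith) (by linarith) (by linarith) (by linarith) (by linarith)
    (by linarith)
  linarith

theorem not_two_pairs {a b c : ℂ} (ha : normSq a ≤ 1) (hb : normSq b ≤ 1) (hc : normSq c ≤ 1)
    (h₁ : 3 < normSq (a + omega * (b + c))) (h₂ : 3 < normSq (a + omega ^ 2 * (b + c)))
    (h₃ : 3 < normSq (b + omega * (a + c))) (h₄ : 3 < normSq (b + omega ^ 2 * (a + c))) :
    False := by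
  obtain ⟨u, hu, hu'⟩ := exists_normSq_one_mul_eq_norm (a + b + c)
  have key : ∀ z : ℂ, normSq (u * z) = normSq z := fun z ↦ by rw [normSq_mul, hu, one_mul]
  have key' : ∀ x y z w : ℂ, normSq (u * x + w * (u * y + u * z)) = normSq (x + w * (y + z)) :=
    fun x y z w ↦ by rw [← key (x + w * (y + z))]; ring_nf
  have hs : 0 < √3 := by positivity
  refine not_two_pairs_of_real (a := u * a) (b := u * b) (c := u * c)
    (h := ‖a + b + c‖ / (2 * √3)) (by rwa [key]) (by rwa [key]) (by rwa [key]) (by positivity) ?_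
    (by rwa [key']) (by rwa [key']) (by rwa [key']) (by rwa [key'])
  rw [mul_div_cancel₀ _ (by positivity), ← hu']
  ring

theorem le_add_mul_of_sq_eq {x y r q : ℝ} (hq : 0 < q) (hq3 : q ^ 2 = 3) (hy : 0 ≤ y)
    (hr : 0 ≤ r) (hr2 : r ^ 2 = x ^ 2 + y ^ 2) (hx : -(r / 2) ≤ x) : r ≤ x + q * y := by
  have hxr : x ≤ r := by nlinarith [sq_nonneg y]
  have h2 : (r - x) ^ 2 ≤ (q * y) ^ 2 := by
    rw [mul_pow, hq3, show y ^ 2 = (r - x) * (r + x) by linear_combination -hr2]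
    nlinarith
  have h3 := le_of_sq_le_sq h2 (by positivity)
  linarith

theorem mul_lt_sub_two_mul {D r s q : ℝ} (hq : 0 < q) (hq3 : q ^ 2 = 3) (hD : 0 ≤ D)
    (hD2 : D ≤ 2) (hs : 0 ≤ s) (hs2 : s ^ 2 = 4 - D ^ 2) (hr : r ≤ 1)
    (h : D * r < D ^ 2 + r ^ 2 - 3) : q * s < D - 2 * r := by
  have hqs : 0 ≤ q * s := by positivity
  have h4 : (q * s) ^ 2 = 3 * (4 - D ^ 2) := by rw [mul_pow, hq3, hs2]
  have h5 : (q * s) ^ 2 < (2 * r - D) ^ 2 := by linarith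
  by_contra! hc
  rcases le_total (2 * r) D with h2 | h2
  · have : (D - 2 * r) ^ 2 ≤ (q * s) ^ 2 := pow_le_pow_left₀ (by linarith) hc 2
    linarith
  · have h3 : (2 * r - D) ^ 2 ≤ (2 - D) ^ 2 := pow_le_pow_left₀ (by linarith) (by linarith) 2
    nlinarith

theorem triple_contra {D E F R x y f q : ℝ} (hD : 0 < D) (hE : 0 ≤ E) (hf : 0 ≤ f)
    (hEF : E + 3 / 2 * f ≤ F) (hF : F ≤ D) (hR : R ≤ 3 - D * F)
    (h₀ : 3 < D ^ 2 + R + 2 * D * x) (h₁ : 3 < D ^ 2 + R - D * (x + q * y))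
    (h : 3 < E ^ 2 + 3 / 4 * f ^ 2 + R - 2 * E * x + q * f * y) : False := by
  have hsum : 0 < D * (E ^ 2 + 3 / 4 * f ^ 2 + R - 3) + (E + 3 / 2 * f) * (D ^ 2 + R - 3) := by
    have k₁ := mul_le_mul_of_nonneg_left h₀.le (by positivity : 0 ≤ E + f / 2)
    have k₂ := mul_le_mul_of_nonneg_left h₁.le hf
    have k₃ := mul_lt_mul_of_pos_left h hD
    linarith
  have hsq : E ^ 2 + 3 / 4 * f ^ 2 ≤ (E + 3 / 2 * f) ^ 2 := by
    nlinarith only [mul_nonneg hE hf, sq_nonneg f]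
  have hsq' : (E + 3 / 2 * f) ^ 2 ≤ F ^ 2 := pow_le_pow_left₀ (by positivity) hEF 2
  have hRF := mul_le_mul_of_nonneg_left hR (by positivity : 0 ≤ D + (E + 3 / 2 * f))
  have hEF' := mul_le_mul_of_nonneg_right hEF (sub_nonneg.2 hF)
  have := mul_le_mul_of_nonneg_left (add_le_add (hsq.trans hsq') hEF') hD.le
  linarith

theorem triple_aux {D x y f₁ f₂ q : ℝ} (hq : 0 < q) (hq3 : q ^ 2 = 3) (hD : 0 ≤ D) (hy : 0 ≤ y)
    (hf₁ : 0 ≤ f₁) (hf : (D + f₁) ^ 2 + f₂ ^ 2 ≤ 4) (hxy : x ^ 2 + y ^ 2 ≤ 1)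
    (h₀ : 3 < D ^ 2 + (x ^ 2 + y ^ 2) + 2 * D * x)
    (h₁ : 3 < D ^ 2 + (x ^ 2 + y ^ 2) - D * (x + q * y)) :
    (D / 2 + q / 2 * f₂ - x) ^ 2 + (q / 2 * f₁ + y) ^ 2 ≤ 3 := by
  have hDf : 0 ≤ D * f₁ := mul_nonneg hD hf₁
  have hD4 : D ^ 2 ≤ 4 := by nlinarith only [hDf, hf, sq_nonneg f₁, sq_nonneg f₂]
  have hD2 : D ≤ 2 := by nlinarith only [hD4, hD]
  obtain ⟨s, hs, hs2⟩ : ∃ s, 0 ≤ s ∧ s ^ 2 = 4 - D ^ 2 :=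
    ⟨√(4 - D ^ 2), by positivity, Real.sq_sqrt (by linarith)⟩
  obtain ⟨r, hr, hr2⟩ : ∃ r, 0 ≤ r ∧ r ^ 2 = x ^ 2 + y ^ 2 :=
    ⟨√(x ^ 2 + y ^ 2), by positivity, Real.sq_sqrt (by positivity)⟩
  have hr1 : r ≤ 1 := by nlinarith only [hr, hr2, hxy]
  rw [← hr2] at h₀ h₁
  have hW : D * r < D ^ 2 + r ^ 2 - 3 := by
    rcases le_total x (-(r / 2)) with hx | hx
    · have := mul_le_mul_of_nonneg_left hx hD
      linarith
    · have := mul_le_mul_of_nonneg_left (le_add_mul_of_sq_eq hq hq3 hy hr hr2 hx) hD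
      linarith
  have hW3 := mul_lt_sub_two_mul hq hq3 hD hD2 hs hs2 hr1 hW
  have hqs : 0 ≤ q * s := by positivity
  have hqs2 : (q * s) ^ 2 = 3 * (4 - D ^ 2) := by rw [mul_pow, hq3, hs2]
  have hE : r ^ 2 ≤ 3 - D * ((D + q * s) / 2) := by
    have := pow_le_pow_left₀ (by linarith) (by linarith : 2 * r ≤ D - q * s) 2
    linarith
  have hD3 : 3 < D ^ 2 := by nlinarith only [hqs, hqs2, hW3, hr]
  have hDq : q < D := lt_of_pow_lt_pow_left₀ 2 hD (by linarith)
  have hs1 : s < 1 := by nlinarith only [hs, hs2, hD3]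
  have hfs2 : f₂ ^ 2 ≤ s ^ 2 := by nlinarith only [hDf, hf, hs2, sq_nonneg f₁]
  obtain ⟨hfs', hfs⟩ := abs_le_of_sq_le_sq' hfs2 hs
  have hE1 : 0 ≤ (D + q * f₂) / 2 := by
    have := mul_le_mul_of_nonneg_left hfs' hq.le
    linarith
  have hM : (D + q * f₂) / 2 + 3 / 2 * f₁ ≤ (D + q * s) / 2 := by
    have h3 : D * f₁ ≤ s - f₂ := by
      nlinarith only [hf, hs2, hfs, hfs', hs1, hs, sq_nonneg f₁,
        mul_nonneg (sub_nonneg.2 hfs) (by linarith : 0 ≤ 2 - (s + f₂))]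
    have h4 : q * f₁ ≤ D * f₁ := mul_le_mul_of_nonneg_right hDq.le hf₁
    have h5 := mul_le_mul_of_nonneg_left (h4.trans h3) hq.le
    linear_combination h5 / 2 - f₁ / 2 * hq3
  by_contra! hc
  have hc' : 3 < ((D + q * f₂) / 2) ^ 2 + 3 / 4 * f₁ ^ 2 + r ^ 2 - 2 * ((D + q * f₂) / 2) * x
      + q * f₁ * y := by
    linear_combination hc + f₁ ^ 2 / 4 * hq3 - hr2
  have hDs : (D + q * s) / 2 ≤ D := by linarith
  exact triple_contra (hq.trans hDq) hE1 hf₁ hM hDs hE h₀ h₁ hc'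

theorem triple_of_real {a b c : ℂ} {D : ℝ} (hD : 0 ≤ D) (hac : a + c = D) (ha : normSq a ≤ 1)
    (hb : normSq b ≤ 1) (hc : normSq c ≤ 1) (h₀ : 3 < normSq (a + b + c))
    (h₁ : 3 < normSq (a + omega * b + c)) (h₂ : 3 < normSq (a + omega ^ 2 * b + c)) :
    normSq (a + b + omega * c) ≤ 3 := by
  have hq : √3 ^ 2 = 3 := Real.sq_sqrt (by norm_num)
  have hq0 : 0 < √3 := by positivity
  obtain ⟨a₁, a₂⟩ := a
  obtain ⟨b₁, b₂⟩ := b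
  obtain rfl : c = D - ⟨a₁, a₂⟩ := by rw [← hac]; ring
  rw [omega_sq] at h₂
  simp only [normSq_apply, omega, add_re, add_im, mul_re, mul_im, sub_re, sub_im, ofReal_re,
    ofReal_im] at *
  generalize √3 = q at *
  set x := -b₁ / 2 - q / 2 * b₂ with hx
  set y := q / 2 * b₁ - b₂ / 2 with hy
  have hxy : x ^ 2 + y ^ 2 = b₁ ^ 2 + b₂ ^ 2 := by grind
  have h := triple_aux (D := D) (x := x) (y := |y|) (f₁ := |2 * a₁ - D|) (f₂ := 2 * a₂) hq0 hq hD
    (abs_nonneg _) (abs_nonneg _) ?_ ?_ ?_ ?_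
  · have e' : (q / 2 * (2 * a₁ - D) + y) ^ 2 ≤ (q / 2 * |2 * a₁ - D| + |y|) ^ 2 := by
      rw [sq_le_sq]
      refine (abs_add_le _ _).trans ?_
      rw [abs_mul, abs_of_pos (by positivity : 0 < q / 2)]
      exact le_abs_self _
    linear_combination h + e' - ((a₂ + b₂ / 2) ^ 2 + (a₁ - D / 2 + b₁ / 2) ^ 2
      - ((D - a₁) ^ 2 + a₂ ^ 2) / 4) * hq
  · rcases abs_cases (2 * a₁ - D) with h | h <;> rw [h.1] <;> linarith
  · rw [sq_abs]; linarith
  · rw [sq_abs]; linear_combination h₁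
  · rw [sq_abs]
    rcases abs_cases y with h | h <;> rw [h.1]
    · linear_combination h₂ + D * b₁ / 2 * hq
    · linear_combination h₀ - (D * b₁ / 2 + (b₁ ^ 2 + b₂ ^ 2) / 4) * hq

theorem triple {a b c : ℂ} (ha : normSq a ≤ 1)
    (hb : normSq b ≤ 1) (hc : normSq c ≤ 1) (h₀ : 3 < normSq (a + b + c))
    (h₁ : 3 < normSq (a + omega * b + c)) (h₂ : 3 < normSq (a + omega ^ 2 * b + c)) :
    normSq (a + b + omega * c) ≤ 3 := by
  obtain ⟨u, hu, hu'⟩ := exists_normSq_one_mul_eq_norm (a + c)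
  have key : ∀ z : ℂ, normSq (u * z) = normSq z := fun z ↦ by rw [normSq_mul, hu, one_mul]
  have key' : ∀ v w : ℂ, normSq (u * a + v * (u * b) + w * (u * c)) =
      normSq (a + v * b + w * c) := fun v w ↦ by rw [← key (a + v * b + w * c)]; ring_nf
  have k₀ := key' 1 1
  have k₁ := key' omega 1
  have k₂ := key' (omega ^ 2) 1
  have k₃ := key' 1 omega
  simp only [one_mul] at k₀ k₁ k₂ k₃
  rw [← k₃]
  exact triple_of_real (norm_nonneg (a + c)) (by rw [← hu']; ring) (by rwa [key]) (by rwa [key])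
    (by rwa [key]) (by rwa [k₀]) (by rwa [k₁]) (by rwa [k₂])

theorem line_sum (a b c : ℂ) :
    normSq (a + b + c) + normSq (a + omega * b + omega ^ 2 * c) +
      normSq (a + omega ^ 2 * b + omega * c) = 3 * (normSq a + normSq b + normSq c) := by
  have hq : √3 ^ 2 = 3 := Real.sq_sqrt (by norm_num)
  rw [omega_sq]
  simp only [normSq_apply, omega, add_re, add_im, mul_re, mul_im]
  grind

/-- The character `i ↦ ω ^ i` of `ℤ / 3`. -/
noncomputable def chi (i : Fin 3) : ℂ := omega ^ (i : ℕ)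

theorem chi_zero : chi 0 = 1 := by simp [chi]

theorem chi_one : chi 1 = omega := by simp [chi]

theorem chi_two : chi 2 = omega ^ 2 := by simp [chi]

theorem chi_add (i j : Fin 3) : chi (i + j) = chi i * chi j := by
  rw [chi, chi, chi, ← pow_add, Fin.val_add, ← pow_eq_pow_mod _ omega_pow_three]

theorem normSq_chi (i : Fin 3) : normSq (chi i) = 1 := by
  rw [chi, map_pow, normSq_omega, one_pow]

/-- The squared modulus of the twisted sum `a + ω ^ i * b + ω ^ j * c` exceeds `3`. -/
def Large (a b c : ℂ) (i j : Fin 3) : Prop := 3 < normSq (a + chi i * b + chi j * c)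

theorem large_add (a b c : ℂ) (i j k l : Fin 3) :
    Large a b c (i + k) (j + l) ↔ Large a (chi i * b) (chi j * c) k l := by
  rw [Large, Large, chi_add, chi_add]
  ring_nf

theorem large_of_normSq_eq {a b c z w : ℂ} {i j : Fin 3} (h : Large a b c i j)
    (hw : normSq w = 1) (hz : a + chi i * b + chi j * c = w * z) : 3 < normSq z := by
  rwa [Large, hz, normSq_mul, hw, one_mul] at h

theorem not_large_line {a b c : ℂ} (ha : normSq a ≤ 1) (hb : normSq b ≤ 1) (hc : normSq c ≤ 1)
    (h₁ : Large a b c 0 0) (h₂ : Large a b c 1 2) : ¬ Large a b c 2 1 := by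
  intro h₃
  have := line_sum a b c
  simp only [Large, chi_zero, chi_one, chi_two, one_mul] at h₁ h₂ h₃
  linarith

theorem normSq_omega_sq : normSq (omega ^ 2) = 1 := by rw [map_pow, normSq_omega, one_pow]

theorem not_large_cross₁₂ {a b c : ℂ} (ha : normSq a ≤ 1) (hb : normSq b ≤ 1)
    (hc : normSq c ≤ 1) (h₁ : Large a b c 1 1) (h₂ : Large a b c 2 2) (h₃ : Large a b c 2 0) :
    ¬ Large a b c 1 0 := by
  intro h₄
  have h := omega_pow_three
  refine not_two_pairs ha hb hc (large_of_normSq_eq h₁ normSq_one ?_)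
    (large_of_normSq_eq h₂ normSq_one ?_) (large_of_normSq_eq h₃ normSq_omega_sq ?_)
    (large_of_normSq_eq h₄ normSq_omega ?_) <;> simp only [chi_zero, chi_one, chi_two] <;> grind

theorem not_large_cross₁₃ {a b c : ℂ} (ha : normSq a ≤ 1) (hb : normSq b ≤ 1)
    (hc : normSq c ≤ 1) (h₁ : Large a b c 1 1) (h₂ : Large a b c 2 2) (h₃ : Large a b c 0 2) :
    ¬ Large a b c 0 1 := by
  intro h₄
  have h := omega_pow_three
  refine not_two_pairs ha hc hb (large_of_normSq_eq h₁ normSq_one ?_)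
    (large_of_normSq_eq h₂ normSq_one ?_) (large_of_normSq_eq h₃ normSq_omega_sq ?_)
    (large_of_normSq_eq h₄ normSq_omega ?_) <;> simp only [chi_zero, chi_one, chi_two] <;> grind

theorem not_large_cross₂₃ {a b c : ℂ} (ha : normSq a ≤ 1) (hb : normSq b ≤ 1)
    (hc : normSq c ≤ 1) (h₁ : Large a b c 2 0) (h₂ : Large a b c 1 0) (h₃ : Large a b c 0 2) :
    ¬ Large a b c 0 1 := by
  intro h₄
  have h := omega_pow_three
  refine not_two_pairs hb hc ha (large_of_normSq_eq h₁ normSq_omega_sq ?_)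
    (large_of_normSq_eq h₂ normSq_omega ?_) (large_of_normSq_eq h₃ normSq_omega_sq ?_)
    (large_of_normSq_eq h₄ normSq_omega ?_) <;> simp only [chi_zero, chi_one, chi_two] <;> grind

theorem not_large_of_column {a b c : ℂ} (ha : normSq a ≤ 1) (hb : normSq b ≤ 1)
    (hc : normSq c ≤ 1) (h₁ : Large a b c 0 0) (h₂ : Large a b c 1 0) (h₃ : Large a b c 2 0) :
    ¬ (Large a b c 0 1 ∨ Large a b c 0 2) := by
  have h := omega_pow_three
  have hωb : normSq (omega * b) ≤ 1 := by rwa [normSq_mul, normSq_omega, one_mul]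
  rintro (h₄ | h₄)
  · refine (triple ha hb hc (large_of_normSq_eq h₁ normSq_one ?_)
      (large_of_normSq_eq h₂ normSq_one ?_) (large_of_normSq_eq h₃ normSq_one ?_)).not_gt
      (large_of_normSq_eq h₄ normSq_one ?_) <;> simp only [chi_zero, chi_one, chi_two] <;> grind
  · refine (triple hc hωb ha (large_of_normSq_eq h₂ normSq_one ?_)
      (large_of_normSq_eq h₃ normSq_one ?_) (large_of_normSq_eq h₁ normSq_one ?_)).not_gt
      (large_of_normSq_eq h₄ normSq_omega_sq ?_) <;> simp only [chi_zero, chi_one, chi_two] <;>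
      grind

theorem large_comm {a b c : ℂ} {i j : Fin 3} : Large a b c i j ↔ Large a c b j i := by
  rw [Large, Large, add_right_comm]

theorem not_large_of_diagonal {a b c : ℂ} (ha : normSq a ≤ 1) (hb : normSq b ≤ 1)
    (hc : normSq c ≤ 1) (h₁ : Large a b c 0 0) (h₂ : Large a b c 1 1) (h₃ : Large a b c 2 2) :
    ¬ (Large a b c 0 1 ∨ Large a b c 0 2) := by
  have h := omega_pow_three
  have hωa : normSq (omega * a) ≤ 1 := by rwa [normSq_mul, normSq_omega, one_mul]
  rintro (h₄ | h₄)
  · refine (triple hb ha hc (large_of_normSq_eq h₁ normSq_one ?_)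
      (large_of_normSq_eq h₃ normSq_omega_sq ?_) (large_of_normSq_eq h₂ normSq_omega ?_)).not_gt
      (large_of_normSq_eq h₄ normSq_one ?_) <;> simp only [chi_zero, chi_one, chi_two] <;> grind
  · refine (triple hc hωa hb (large_of_normSq_eq h₃ normSq_omega_sq ?_)
      (large_of_normSq_eq h₂ normSq_omega ?_) (large_of_normSq_eq h₁ normSq_one ?_)).not_gt
      (large_of_normSq_eq h₄ normSq_omega_sq ?_) <;> simp only [chi_zero, chi_one, chi_two] <;>
      grind

/-- The combinatorial constraints satisfied by the set of pairs `(i, j)` for which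
`Large a b c i j` holds. -/
def Admissible (P : Fin 3 → Fin 3 → Prop) : Prop :=
  (∀ i j : Fin 3, ¬(P i j ∧ P (i + 1) (j + 2) ∧ P (i + 2) (j + 1))) ∧
  (∀ i j : Fin 3, ¬(P (i + 1) (j + 1) ∧ P (i + 2) (j + 2) ∧ P (i + 2) j ∧ P (i + 1) j)) ∧
  (∀ i j : Fin 3, ¬(P (i + 1) (j + 1) ∧ P (i + 2) (j + 2) ∧ P i (j + 2) ∧ P i (j + 1))) ∧
  (∀ i j : Fin 3, ¬(P (i + 2) j ∧ P (i + 1) j ∧ P i (j + 2) ∧ P i (j + 1))) ∧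
  (∀ j k : Fin 3, ¬((∀ l, P l j) ∧ (P k (j + 1) ∨ P k (j + 2)))) ∧
  (∀ i k : Fin 3, ¬((∀ l, P i l) ∧ (P (i + 1) k ∨ P (i + 2) k))) ∧
  (∀ j k : Fin 3, ¬((∀ l, P l (j + l)) ∧ (P k (j + k + 1) ∨ P k (j + k + 2))))

theorem Admissible.mono {P Q : Fin 3 → Fin 3 → Prop} (h : ∀ i j, P i j → Q i j)
    (hQ : Admissible Q) : Admissible P := by
  obtain ⟨h₁, h₂, h₃, h₄, h₅, h₆, h₇⟩ := hQ
  exact ⟨fun i j hp ↦ h₁ i j (hp.imp (h _ _) (.imp (h _ _) (h _ _))),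
    fun i j hp ↦ h₂ i j (hp.imp (h _ _) (.imp (h _ _) (.imp (h _ _) (h _ _)))),
    fun i j hp ↦ h₃ i j (hp.imp (h _ _) (.imp (h _ _) (.imp (h _ _) (h _ _)))),
    fun i j hp ↦ h₄ i j (hp.imp (h _ _) (.imp (h _ _) (.imp (h _ _) (h _ _)))),
    fun i j hp ↦ h₅ i j (hp.imp (fun k l ↦ h _ _ (k l)) (.imp (h _ _) (h _ _))),
    fun i j hp ↦ h₆ i j (hp.imp (fun k l ↦ h _ _ (k l)) (.imp (h _ _) (h _ _))),
    fun i j hp ↦ h₇ i j (hp.imp (fun k l ↦ h _ _ (k l)) (.imp (h _ _) (h _ _)))⟩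

theorem admissible_large {a b c : ℂ} (ha : normSq a ≤ 1) (hb : normSq b ≤ 1)
    (hc : normSq c ≤ 1) : Admissible (Large a b c) := by
  have key : ∀ {z : ℂ} (i : Fin 3), normSq z ≤ 1 → normSq (chi i * z) ≤ 1 := fun i hz ↦ by
    rwa [normSq_mul, normSq_chi, one_mul]
  have e : ∀ {i j k l k' l' : Fin 3}, Large a b c k' l' → k' = i + k → l' = j + l →
      Large a (chi i * b) (chi j * c) k l := by
    rintro i j k l _ _ h rfl rfl
    rwa [← large_add]
  refine ⟨?_, ?_, ?_, ?_, ?_, ?_, ?_⟩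
  · rintro i j ⟨h₁, h₂, h₃⟩
    exact not_large_line ha (key i hb) (key j hc) (e h₁ (by simp) (by simp)) (e h₂ rfl rfl)
      (e h₃ rfl rfl)
  · rintro i j ⟨h₁, h₂, h₃, h₄⟩
    exact not_large_cross₁₂ ha (key i hb) (key j hc) (e h₁ rfl rfl) (e h₂ rfl rfl)
      (e h₃ rfl (by simp)) (e h₄ rfl (by simp))
  · rintro i j ⟨h₁, h₂, h₃, h₄⟩
    exact not_large_cross₁₃ ha (key i hb) (key j hc) (e h₁ rfl rfl) (e h₂ rfl rfl)
      (e h₃ (by simp) rfl) (e h₄ (by simp) rfl)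
  · rintro i j ⟨h₁, h₂, h₃, h₄⟩
    exact not_large_cross₂₃ ha (key i hb) (key j hc) (e h₁ rfl (by simp)) (e h₂ rfl (by simp))
      (e h₃ (by simp) rfl) (e h₄ (by simp) rfl)
  · rintro j k ⟨h₁, h₂⟩
    refine not_large_of_column ha (key k hb) (key j hc) (e (h₁ k) (by simp) (by simp))
      (e (h₁ (k + 1)) rfl (by simp)) (e (h₁ (k + 2)) rfl (by simp)) ?_
    exact h₂.imp (fun h ↦ e h (by simp) rfl) (fun h ↦ e h (by simp) rfl)
  · rintro i k ⟨h₁, h₂⟩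
    refine not_large_of_column ha (key k hc) (key i hb)
      (large_comm.1 (e (h₁ k) (by simp) (by simp))) (large_comm.1 (e (h₁ (k + 1)) (by simp) rfl))
      (large_comm.1 (e (h₁ (k + 2)) (by simp) rfl)) ?_
    exact h₂.imp (fun h ↦ large_comm.1 (e h rfl (by simp)))
      (fun h ↦ large_comm.1 (e h rfl (by simp)))
  · rintro j k ⟨h₁, h₂⟩
    refine not_large_of_diagonal ha (key k hb) (key (j + k) hc) (e (h₁ k) (by simp) (by simp))
      (e (h₁ (k + 1)) rfl (add_assoc _ _ _).symm) (e (h₁ (k + 2)) rfl (add_assoc _ _ _).symm) ?_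
    exact h₂.imp (fun h ↦ e h (by simp) rfl) (fun h ↦ e h (by simp) rfl)

instance (P : Fin 3 → Fin 3 → Prop) [∀ i j, Decidable (P i j)] : Decidable (Admissible P) := by
  unfold Admissible
  infer_instance

set_option maxRecDepth 100000 in
theorem not_admissible_and_admissible_compl : ∀ a b c d e f g h i : Bool,
    ¬ (Admissible (fun x y ↦ ![![a, b, c], ![d, e, f], ![g, h, i]] x y = true) ∧
      Admissible (fun x y ↦ ![![a, b, c], ![d, e, f], ![g, h, i]] x y = false ∧
        (x, y) ≠ (0, 0))) := by
  decide +kernel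

theorem Admissible.exists_not_and_not {P Q : Fin 3 → Fin 3 → Prop} (hP : Admissible P)
    (hQ : Admissible Q) : ∃ i j, (i, j) ≠ (0, 0) ∧ ¬ P i j ∧ ¬ Q i j := by
  classical
  by_contra! H
  have e : ∀ x y, ![![decide (P 0 0), decide (P 0 1), decide (P 0 2)],
      ![decide (P 1 0), decide (P 1 1), decide (P 1 2)],
      ![decide (P 2 0), decide (P 2 1), decide (P 2 2)]] x y = decide (P x y) := by
    intro x y
    fin_cases x <;> fin_cases y <;> rfl
  refine not_admissible_and_admissible_compl (decide (P 0 0)) (decide (P 0 1)) (decide (P 0 2))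
    (decide (P 1 0)) (decide (P 1 1)) (decide (P 1 2)) (decide (P 2 0)) (decide (P 2 1))
    (decide (P 2 2)) ⟨hP.mono fun i j h ↦ ?_, hQ.mono fun i j h ↦ ?_⟩
  · simpa [e] using h
  · rw [e] at h
    exact H i j h.2 (by simpa using h.1)

theorem le_three_of_corners {A B r α β γ : ℝ} (hr : r ≤ 1) (hA : r ≤ A) (hA1 : A ≤ 1)
    (hB : r ≤ B) (hB1 : B ≤ 1) (h₁₁ : 2 + r ^ 2 + 2 * (α + r * β + r * γ) ≤ 3)
    (h₁₂ : 1 + 2 * r ^ 2 + 2 * (r * α + r * β + r ^ 2 * γ) ≤ 3)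
    (h₂₁ : 1 + 2 * r ^ 2 + 2 * (r * α + r ^ 2 * β + r * γ) ≤ 3)
    (h₂₂ : 3 * r ^ 2 + 2 * (r ^ 2 * α + r ^ 2 * β + r ^ 2 * γ) ≤ 3) :
    A ^ 2 + B ^ 2 + r ^ 2 + 2 * (A * B * α + A * r * β + B * r * γ) ≤ 3 := by
  have key : ∀ x, r ≤ x → x ≤ 1 → ∃ s, 0 ≤ s ∧ 0 ≤ 1 - s ∧ x = s + (1 - s) * r := by
    intro x hx hx1
    rcases hr.lt_or_eq with h | rfl
    · have h' : 0 < 1 - r := by linarith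
      refine ⟨(x - r) / (1 - r), div_nonneg (by linarith) h'.le, ?_, ?_⟩
      · rw [sub_nonneg, div_le_one h']
        linarith
      · field_simp
        ring
    · exact ⟨0, by simp, by simp, by linarith⟩
  obtain ⟨s, hs, hs', rfl⟩ := key A hA hA1
  obtain ⟨u, hu, hu', rfl⟩ := key B hB hB1
  have k₁ := mul_le_mul_of_nonneg_left h₁₁ (mul_nonneg hs hu)
  have k₂ := mul_le_mul_of_nonneg_left h₁₂ (mul_nonneg hs hu')
  have k₃ := mul_le_mul_of_nonneg_left h₂₁ (mul_nonneg hs' hu)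
  have k₄ := mul_le_mul_of_nonneg_left h₂₂ (mul_nonneg hs' hu')
  have k₅ := mul_nonneg (mul_nonneg hs hs') (sq_nonneg (1 - r))
  have k₆ := mul_nonneg (mul_nonneg hu hu') (sq_nonneg (1 - r))
  linear_combination k₁ + k₂ + k₃ + k₄ + k₅ + k₆

theorem center_le₀₁ {A B r p : ℝ} (hr0 : 0 ≤ r) (hr : r ≤ 1) (hA : r ≤ A) (hA1 : A ≤ 1)
    (hB : r ≤ B) (hB1 : B ≤ 1) (hp : 0 ≤ p) (hpr : p ^ 2 = 3 - 3 / 4 * r ^ 2) :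
    A ^ 2 + B ^ 2 + r ^ 2 + 2 * (A * B * (1 / 2 - r ^ 2 / 4 + r * p / 2) +
      A * r * (-p / 2 + r / 4) + B * r * (-r / 2)) ≤ 3 := by
  have hp1 : 3 / 2 ≤ p := by nlinarith
  have hp2 : p ≤ 7 / 4 := by nlinarith
  apply le_three_of_corners hr hA hA1 hB hB1 <;>
    nlinarith [mul_nonneg hr0 (sub_nonneg.2 hr), mul_nonneg hr0 (sub_nonneg.2 hp1),
      mul_nonneg hr0 (sub_nonneg.2 hp2)]

theorem center_le₁₀ {A B r p : ℝ} (hr0 : 0 ≤ r) (hr : r ≤ 1) (hA : r ≤ A) (hA1 : A ≤ 1)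
    (hB : r ≤ B) (hB1 : B ≤ 1) (hp : 0 ≤ p) (hpr : p ^ 2 = 3 - 3 / 4 * r ^ 2) :
    A ^ 2 + B ^ 2 + r ^ 2 + 2 * (A * B * (-1 + r ^ 2 / 2) + A * r * (p / 2 + r / 4) +
      B * r * (-p / 2 + r / 4)) ≤ 3 := by
  have hp1 : 3 / 2 ≤ p := by nlinarith
  have hp2 : p ≤ 7 / 4 := by nlinarith
  apply le_three_of_corners hr hA hA1 hB hB1 <;>
    nlinarith [mul_nonneg hr0 (sub_nonneg.2 hr), mul_nonneg hr0 (sub_nonneg.2 hp1),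
      mul_nonneg hr0 (sub_nonneg.2 hp2)]

theorem center_le₁₂ {A B r p : ℝ} (hr0 : 0 ≤ r) (hr : r ≤ 1) (hA : r ≤ A) (hA1 : A ≤ 1)
    (hB : r ≤ B) (hB1 : B ≤ 1) (hp : 0 ≤ p) (hpr : p ^ 2 = 3 - 3 / 4 * r ^ 2) :
    A ^ 2 + B ^ 2 + r ^ 2 + 2 * (A * B * (-1 + r ^ 2 / 2) + A * r * (-r / 2) +
      B * r * (-r / 2)) ≤ 3 := by
  have hp1 : 3 / 2 ≤ p := by nlinarith
  have hp2 : p ≤ 7 / 4 := by nlinarith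
  apply le_three_of_corners hr hA hA1 hB hB1 <;>
    nlinarith [mul_nonneg hr0 (sub_nonneg.2 hr), mul_nonneg hr0 (sub_nonneg.2 hp1),
      mul_nonneg hr0 (sub_nonneg.2 hp2)]

theorem center_le₂₀ {A B r p : ℝ} (hr0 : 0 ≤ r) (hr : r ≤ 1) (hA : r ≤ A) (hA1 : A ≤ 1)
    (hB : r ≤ B) (hB1 : B ≤ 1) (hp : 0 ≤ p) (hpr : p ^ 2 = 3 - 3 / 4 * r ^ 2) :
    A ^ 2 + B ^ 2 + r ^ 2 + 2 * (A * B * (1 / 2 - r ^ 2 / 4 - r * p / 2) + A * r * (p / 2 + r / 4) +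
      B * r * (-r / 2)) ≤ 3 := by
  have hp1 : 3 / 2 ≤ p := by nlinarith
  have hp2 : p ≤ 7 / 4 := by nlinarith
  have hp3 : p ≤ 2 - r / 2 := by nlinarith
  have h1 : 0 ≤ (1 - r) * (2 + r - 3 / 2 * r ^ 2 - r * p) :=
    mul_nonneg (by linarith) (by nlinarith)
  apply le_three_of_corners hr hA hA1 hB hB1 <;>
    nlinarith [mul_nonneg hr0 (sub_nonneg.2 hr), mul_nonneg hr0 (sub_nonneg.2 hp1),
      mul_nonneg hr0 (sub_nonneg.2 hp2)]

theorem center_le₂₁ {A B r p : ℝ} (hr0 : 0 ≤ r) (hr : r ≤ 1) (hA : r ≤ A) (hA1 : A ≤ 1)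
    (hB : r ≤ B) (hB1 : B ≤ 1) (hp : 0 ≤ p) (hpr : p ^ 2 = 3 - 3 / 4 * r ^ 2) :
    A ^ 2 + B ^ 2 + r ^ 2 + 2 * (A * B * (1 / 2 - r ^ 2 / 4 - r * p / 2) +
      A * r * (-p / 2 + r / 4) + B * r * (-p / 2 + r / 4)) ≤ 3 := by
  have hp1 : 3 / 2 ≤ p := by nlinarith
  have hp2 : p ≤ 7 / 4 := by nlinarith
  apply le_three_of_corners hr hA hA1 hB hB1 <;>
    nlinarith [mul_nonneg hr0 (sub_nonneg.2 hr), mul_nonneg hr0 (sub_nonneg.2 hp1),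
      mul_nonneg hr0 (sub_nonneg.2 hp2)]

theorem exists_not_large_of_real {A B r : ℝ} (hr0 : 0 ≤ r) (hr : r ≤ 1) (hA : r ≤ A)
    (hA1 : A ≤ 1) (hB : r ≤ B) (hB1 : B ≤ 1) : ∃ E : ℂ, normSq E = 1 ∧
      ∀ i j, (i, j) ≠ (0, 0) → ¬ Large (starRingEnd ℂ E * A) (E * B) r i j := by
  have hq : √3 ^ 2 = 3 := Real.sq_sqrt (by norm_num)
  obtain ⟨p, hp, hpr⟩ : ∃ p, 0 ≤ p ∧ p ^ 2 = 3 - 3 / 4 * r ^ 2 :=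
    ⟨√(3 - 3 / 4 * r ^ 2), by positivity, Real.sq_sqrt (by nlinarith)⟩
  refine ⟨⟨p / 2 + r / 4, √3 * (p / 6 - r / 4)⟩, ?_, fun i j hij ↦ not_lt.2 ?_⟩
  · simp only [normSq_apply]
    linear_combination (p / 6 - r / 4) ^ 2 * hq + hpr / 3
  match i, j with
  | 0, 0 => exact absurd rfl hij
  | 0, 1 =>
    refine Eq.trans_le ?_ (center_le₀₁ hr0 hr hA hA1 hB hB1 hp hpr)
    simp only [chi_zero, chi_one, one_mul]
    simp only [normSq_apply, omega, add_re, add_im, mul_re, mul_im,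
      ofReal_re, ofReal_im, conj_re, conj_im]
    clear hr0 hr hA hA1 hB hB1 hp hij
    grind only
  | 0, 2 =>
    refine Eq.trans_le ?_ (center_le₀₁ hr0 hr hB hB1 hA hA1 hp hpr)
    simp only [chi_zero, chi_two, omega_sq, one_mul]
    simp only [normSq_apply, add_re, add_im, mul_re, mul_im,
      ofReal_re, ofReal_im, conj_re, conj_im]
    clear hr0 hr hA hA1 hB hB1 hp hij
    grind only
  | 1, 0 =>
    refine Eq.trans_le ?_ (center_le₁₀ hr0 hr hA hA1 hB hB1 hp hpr)
    simp only [chi_zero, chi_one, one_mul]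
    simp only [normSq_apply, omega, add_re, add_im, mul_re, mul_im,
      ofReal_re, ofReal_im, conj_re, conj_im]
    clear hr0 hr hA hA1 hB hB1 hp hij
    grind only
  | 1, 1 =>
    refine Eq.trans_le ?_ (center_le₁₀ hr0 hr hB hB1 hA hA1 hp hpr)
    simp only [chi_one]
    simp only [normSq_apply, omega, add_re, add_im, mul_re, mul_im,
      ofReal_re, ofReal_im, conj_re, conj_im]
    clear hr0 hr hA hA1 hB hB1 hp hij
    grind only
  | 1, 2 =>
    refine Eq.trans_le ?_ (center_le₁₂ hr0 hr hA hA1 hB hB1 hp hpr)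
    simp only [chi_one, chi_two, omega_sq]
    simp only [normSq_apply, omega, add_re, add_im, mul_re, mul_im,
      ofReal_re, ofReal_im, conj_re, conj_im]
    clear hr0 hr hA hA1 hB hB1 hp hij
    grind only
  | 2, 0 =>
    refine Eq.trans_le ?_ (center_le₂₀ hr0 hr hA hA1 hB hB1 hp hpr)
    simp only [chi_zero, chi_two, omega_sq, one_mul]
    simp only [normSq_apply, add_re, add_im, mul_re, mul_im,
      ofReal_re, ofReal_im, conj_re, conj_im]
    clear hr0 hr hA hA1 hB hB1 hp hij
    grind only
  | 2, 1 =>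
    refine Eq.trans_le ?_ (center_le₂₁ hr0 hr hA hA1 hB hB1 hp hpr)
    simp only [chi_one, chi_two, omega_sq]
    simp only [normSq_apply, omega, add_re, add_im, mul_re, mul_im,
      ofReal_re, ofReal_im, conj_re, conj_im]
    clear hr0 hr hA hA1 hB hB1 hp hij
    grind only
  | 2, 2 =>
    refine Eq.trans_le ?_ (center_le₂₀ hr0 hr hB hB1 hA hA1 hp hpr)
    simp only [chi_two, omega_sq]
    simp only [normSq_apply, add_re, add_im, mul_re, mul_im,
      ofReal_re, ofReal_im, conj_re, conj_im]
    clear hr0 hr hA hA1 hB hB1 hp hij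
    grind only

theorem large_swap {a b c : ℂ} {i j : Fin 3} : Large a b c i j ↔ Large b a c (-i) (j - i) := by
  have h : chi (-i) * chi i = 1 := by rw [← chi_add, neg_add_cancel, chi_zero]
  rw [Large, Large, ← one_mul (normSq (a + _ + _)), ← normSq_chi (-i), ← normSq_mul,
    sub_eq_neg_add, chi_add (-i) j]
  rw [show chi (-i) * (a + chi i * b + chi j * c) = b + chi (-i) * a + chi (-i) * chi j * c by
    linear_combination b * h]

/-- Each triple of complex numbers in the closed unit disc can be rotated coordinatewise so that
no pair other than `(0, 0)` is large. -/
theorem exists_not_large {a b c : ℂ} (ha : normSq a ≤ 1) (hb : normSq b ≤ 1)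
    (hc : normSq c ≤ 1) : ∃ u v w : ℂ, normSq u = 1 ∧ normSq v = 1 ∧ normSq w = 1 ∧
      ∀ i j, (i, j) ≠ (0, 0) → ¬ Large (u * a) (v * b) (w * c) i j := by
  have hmin : ∀ {a b c : ℂ}, normSq a ≤ 1 → normSq b ≤ 1 → ‖c‖ ≤ ‖a‖ → ‖c‖ ≤ ‖b‖ →
      ∃ u v w : ℂ, normSq u = 1 ∧ normSq v = 1 ∧ normSq w = 1 ∧
        ∀ i j, (i, j) ≠ (0, 0) → ¬ Large (u * a) (v * b) (w * c) i j := by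
    intro a b c ha hb hca hcb
    have ha' : ‖a‖ ≤ 1 := by rwa [normSq_eq_norm_sq, sq_le_one_iff₀ (norm_nonneg _)] at ha
    have hb' : ‖b‖ ≤ 1 := by rwa [normSq_eq_norm_sq, sq_le_one_iff₀ (norm_nonneg _)] at hb
    obtain ⟨u, hu, hu'⟩ := exists_normSq_one_mul_eq_norm a
    obtain ⟨v, hv, hv'⟩ := exists_normSq_one_mul_eq_norm b
    obtain ⟨w, hw, hw'⟩ := exists_normSq_one_mul_eq_norm c
    obtain ⟨E, hE, h⟩ := exists_not_large_of_real (norm_nonneg c) (hca.trans ha') hca ha' hcb hb'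
    refine ⟨starRingEnd ℂ E * u, E * v, w, ?_, ?_, hw, ?_⟩
    · rw [normSq_mul, normSq_conj, hE, hu, one_mul]
    · rw [normSq_mul, hE, hv, one_mul]
    · rwa [mul_assoc, mul_assoc, hu', hv', hw']
  by_cases h₁ : ‖c‖ ≤ ‖a‖ ∧ ‖c‖ ≤ ‖b‖
  · exact hmin ha hb h₁.1 h₁.2
  by_cases h₂ : ‖b‖ ≤ ‖a‖ ∧ ‖b‖ ≤ ‖c‖
  · obtain ⟨u, w, v, hu, hw, hv, h⟩ := hmin ha hc h₂.1 h₂.2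
    refine ⟨u, v, w, hu, hv, hw, fun i j hij ↦ ?_⟩
    rw [large_comm]
    exact h j i (by grind)
  · obtain ⟨w, v, u, hw, hv, hu, h⟩ := hmin hc hb (c := a) (by grind) (by grind)
    refine ⟨u, v, w, hu, hv, hw, fun i j hij ↦ ?_⟩
    rw [large_swap, large_comm, large_swap]
    refine h _ _ fun h0 ↦ hij ?_
    clear h
    revert i j
    decide

theorem exists_norm_eq_one_forall_normSq_le_three (M : Fin 3 → Fin 3 → ℂ)
    (hM : ∀ i j, normSq (M i j) ≤ 1) :
    ∃ ε : Fin 3 → ℂ, (∀ j, ‖ε j‖ = 1) ∧ ∀ i, normSq (∑ j, ε j * M i j) ≤ 3 := by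
  obtain ⟨u, v, w, hu, hv, hw, h₀⟩ := exists_not_large (hM 0 0) (hM 0 1) (hM 0 2)
  have key : ∀ {z x : ℂ}, normSq z = 1 → normSq x ≤ 1 → normSq (z * x) ≤ 1 := fun hz hx ↦ by
    rwa [normSq_mul, hz, one_mul]
  have hadm : ∀ i, Admissible (Large (u * M i 0) (v * M i 1) (w * M i 2)) := fun i ↦
    admissible_large (key hu (hM _ _)) (key hv (hM _ _)) (key hw (hM _ _))
  obtain ⟨k, l, hkl, h₁, h₂⟩ := (hadm 1).exists_not_and_not (hadm 2)
  have hε : ∀ {z : ℂ} (i), normSq z = 1 → ‖z * chi i‖ = 1 := fun i hz ↦ by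
    rw [← pow_left_inj₀ (norm_nonneg _) zero_le_one two_ne_zero, one_pow, ← normSq_eq_norm_sq,
      normSq_mul, hz, normSq_chi, one_mul]
  refine ⟨![u * chi 0, v * chi k, w * chi l], ?_, ?_⟩
  · simp only [Fin.forall_fin_succ, IsEmpty.forall_iff, and_true]
    exact ⟨hε 0 hu, hε k hv, hε l hw⟩
  · have : ∀ i, ¬ Large (u * M i 0) (v * M i 1) (w * M i 2) k l := by
      simp [Fin.forall_fin_succ, h₀ k l hkl, h₁, h₂]
    intro i
    refine le_of_eq_of_le (congrArg _ ?_) (not_lt.1 (this i))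
    simp [Fin.sum_univ_three, chi_zero]
    ring

end

theorem opNorm_entry_le (A : PiLp 1 (fun _ : Fin 3 => ℂ) →L[ℂ] PiLp ⊤ (fun _ : Fin 3 => ℂ))
    (i j : Fin 3) : ‖A (PiLp.single 1 j 1) i‖ ≤ ‖A‖ := by
  refine (PiLp.norm_apply_le _ i).trans ((A.le_opNorm _).trans_eq ?_)
  simp

/-- A linear map from `ℓ₁³(ℂ)` to `ℓ_∞³(ℂ)` expands some vector by a factor of at most
`‖A‖ / √3`. -/
theorem exists_norm_apply_le (A : PiLp 1 (fun _ : Fin 3 => ℂ) →L[ℂ] PiLp ⊤ (fun _ : Fin 3 => ℂ)) :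
    ∃ x, ‖x‖ = 3 ∧ ‖A x‖ ≤ √3 * ‖A‖ := by
  rcases eq_or_ne A 0 with rfl | hA
  · exact ⟨PiLp.single 1 0 3, by simp, by simp⟩
  have hK : 0 < ‖A‖ := norm_pos_iff.2 hA
  obtain ⟨ε, hε, h⟩ := exists_norm_eq_one_forall_normSq_le_three
    (fun i j ↦ A (PiLp.single 1 j 1) i / ‖A‖) fun i j ↦ by
      rw [Complex.normSq_eq_norm_sq, sq_le_one_iff₀ (norm_nonneg _), norm_div, Complex.norm_real,
        norm_norm, div_le_one hK]
      exact opNorm_entry_le A i j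
  refine ⟨WithLp.toLp 1 ε, by simp [PiLp.norm_eq_of_L1, hε], ?_⟩
  rw [PiLp.norm_eq_ciSup]
  refine ciSup_le fun i ↦ ?_
  have e : A (WithLp.toLp 1 ε) i = ‖A‖ * ∑ j, ε j * (A (PiLp.single 1 j 1) i / ‖A‖) := by
    have : WithLp.toLp 1 ε = ∑ j, ε j • (PiLp.single 1 j 1 : PiLp 1 (fun _ : Fin 3 => ℂ)) := by
      ext k
      simp [Pi.single_apply]
    have hK' : (‖A‖ : ℂ) ≠ 0 := by exact_mod_cast hK.ne'
    rw [this, map_sum, Finset.mul_sum]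
    simp only [map_smul, WithLp.ofLp_sum, Finset.sum_apply, WithLp.ofLp_smul, Pi.smul_apply,
      smul_eq_mul]
    refine Finset.sum_congr rfl fun j _ ↦ ?_
    field_simp
  rw [e, norm_mul, Complex.norm_real, norm_norm, mul_comm]
  gcongr
  apply Real.le_sqrt_of_sq_le
  rw [← Complex.normSq_eq_norm_sq]
  exact h i

end CubeRoot

/-- Every ℂ-linear homeomorphism `A` from `ℓ₁³(ℂ)` onto `ℓ_∞³(ℂ)` satisfies
`‖A‖ ⬝ ‖A⁻¹‖ ≥ √3`; in particular the Banach–Mazur distance between `ℓ₁³(ℂ)` and `ℓ_∞³(ℂ)`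
is at least `√3`. -/
theorem stmt_7 (A : PiLp 1 (fun _ : Fin 3 => ℂ) ≃L[ℂ] PiLp ⊤ (fun _ : Fin 3 => ℂ)) :
    Real.sqrt 3 ≤
      ‖(A : PiLp 1 (fun _ : Fin 3 => ℂ) →L[ℂ] PiLp ⊤ (fun _ : Fin 3 => ℂ))‖ *
        ‖(A.symm : PiLp ⊤ (fun _ : Fin 3 => ℂ) →L[ℂ] PiLp 1 (fun _ : Fin 3 => ℂ))‖ := by
  obtain ⟨x, hx, h⟩ := CubeRoot.exists_norm_apply_le
    (A : PiLp 1 (fun _ : Fin 3 => ℂ) →L[ℂ] PiLp ⊤ (fun _ : Fin 3 => ℂ))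
  have h₁ := (A.symm : PiLp ⊤ (fun _ : Fin 3 => ℂ) →L[ℂ] PiLp 1 (fun _ : Fin 3 => ℂ)).le_opNorm
    (A x)
  have h₂ : √3 * √3 = 3 := Real.mul_self_sqrt (by norm_num)
  have h₃ : 0 < √3 := by positivity
  refine le_of_mul_le_mul_left ?_ h₃
  simp only [ContinuousLinearEquiv.coe_coe, ContinuousLinearEquiv.symm_apply_apply] at h h₁
  calc √3 * √3 = ‖x‖ := by rw [h₂, hx]
    _ ≤ _ := h₁
    _ ≤ _ := mul_le_mul_of_nonneg_left h (norm_nonneg _)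
    _ = _ := by ring
end

section
/- Let 1 ≤ q ≤ 2 ≤ p ≤ ∞ and set α = max{1/2 − 1/p, 1/q − 1/2} (with the convention 1/∞ = 0). Then for every ℂ-linear homeomorphism A from ℓ_q²(ℂ) onto ℓ_p²(ℂ), one has ‖A‖ · ‖A⁻¹‖ ≥ 2^α, where ‖A‖ is the operator norm of A from ℓ_q²(ℂ) to ℓ_p²(ℂ) and ‖A⁻¹‖ is the operator norm of its inverse from ℓ_p²(ℂ) to ℓ_q²(ℂ). In particular, the Banach–Mazur distance between ℓ_p²(ℂ) and ℓ_q²(ℂ) is exactly 2^α. -/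
open scoped ENNReal

/-- The bilinear form of the matrix `!![1, 1; 1, -1]`, in polar coordinates, is controlled by
interpolating between the exponents `1 / 2` and `1`. -/
theorem norm_hadamard_form_le {s u₁ u₂ v₁ v₂ : ℝ} (hs : 1 / 2 ≤ s) (hs1 : s ≤ 1)
    (hu₁ : 0 ≤ u₁) (hu₂ : 0 ≤ u₂) (hv₁ : 0 ≤ v₁) (hv₂ : 0 ≤ v₂)
    (hu : u₁ + u₂ = 1) (hv : v₁ + v₂ = 1) {e₁ e₂ d₁ d₂ : ℂ}
    (he₁ : ‖e₁‖ ≤ 1) (he₂ : ‖e₂‖ ≤ 1) (hd₁ : ‖d₁‖ ≤ 1) (hd₂ : ‖d₂‖ ≤ 1) :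
    ‖d₁ * (v₁ : ℂ) ^ (s : ℂ) * (e₁ * (u₁ : ℂ) ^ (s : ℂ) + e₂ * (u₂ : ℂ) ^ (s : ℂ)) +
      d₂ * (v₂ : ℂ) ^ (s : ℂ) * (e₁ * (u₁ : ℂ) ^ (s : ℂ) - e₂ * (u₂ : ℂ) ^ (s : ℂ))‖ ≤
      (2 : ℝ) ^ (1 - s) := by
  have hmul : ∀ {e : ℂ} {u : ℝ} {z : ℂ}, ‖e‖ ≤ 1 → 0 ≤ u → 0 < z.re →
      ‖e * (u : ℂ) ^ z‖ ≤ u ^ z.re := by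
    intro e u z he hu hz
    rw [norm_mul, Complex.norm_cpow_eq_rpow_re_of_nonneg hu hz.ne']
    exact mul_le_of_le_one_left (Real.rpow_nonneg hu _) he
  have hone : ∀ {e : ℂ} {u : ℝ} {z : ℂ}, ‖e‖ ≤ 1 → 0 ≤ u → u ≤ 1 → 0 < z.re →
      ‖e * (u : ℂ) ^ z‖ ≤ 1 := fun he hu hu1 hz =>
    (hmul he hu hz).trans (Real.rpow_le_one hu hu1 hz.le)
  have htri : ∀ D E P Q : ℂ, ‖D * (P + Q) + E * (P - Q)‖ ≤ (‖D‖ + ‖E‖) * (‖P‖ + ‖Q‖) := by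
    intro D E P Q
    calc ‖D * (P + Q) + E * (P - Q)‖ ≤ ‖D‖ * ‖P + Q‖ + ‖E‖ * ‖P - Q‖ := by
          simpa only [norm_mul] using norm_add_le (D * (P + Q)) (E * (P - Q))
      _ ≤ ‖D‖ * (‖P‖ + ‖Q‖) + ‖E‖ * (‖P‖ + ‖Q‖) := by
          gcongr
          · exact norm_add_le _ _
          · exact norm_sub_le _ _
      _ = _ := by ring
  let F : ℂ → ℂ := fun z => d₁ * (v₁ : ℂ) ^ z * (e₁ * (u₁ : ℂ) ^ z + e₂ * (u₂ : ℂ) ^ z) +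
      d₂ * (v₂ : ℂ) ^ z * (e₁ * (u₁ : ℂ) ^ z - e₂ * (u₂ : ℂ) ^ z)
  have hdiff : ∀ z : ℂ, 0 < z.re → DifferentiableAt ℂ F z := by
    intro z hz
    have hz0 : z ≠ 0 := by rintro rfl; simp at hz
    have h : ∀ u : ℝ, DifferentiableAt ℂ (fun z : ℂ => (u : ℂ) ^ z) z := fun u =>
      differentiableAt_id.const_cpow (Or.inr hz0)
    have h1 := h u₁
    have h2 := h u₂
    have h3 := h v₁
    have h4 := h v₂
    fun_prop
  have hD : DiffContOnCl ℂ F (Complex.HadamardThreeLines.verticalStrip (1 / 2) 1) := by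
    apply DifferentiableOn.diffContOnCl
    intro z hz
    apply (hdiff z _).differentiableWithinAt
    have hsub : closure (Complex.HadamardThreeLines.verticalStrip (1 / 2) 1) ⊆
        Complex.re ⁻¹' Set.Icc (1 / 2) 1 := by
      apply closure_minimal
      · exact Set.preimage_mono Set.Ioo_subset_Icc_self
      · exact isClosed_Icc.preimage Complex.continuous_re
    have := (hsub hz).1
    linarith
  have hB : BddAbove ((norm ∘ F) '' Complex.HadamardThreeLines.verticalClosedStrip (1 / 2) 1) := by
    refine ⟨4, ?_⟩
    rintro _ ⟨z, hz, rfl⟩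
    have hz0 : 0 < z.re := by have := hz.1; linarith
    refine (htri _ _ _ _).trans ?_
    have h1 := hone he₁ hu₁ (by linarith) hz0
    have h2 := hone he₂ hu₂ (by linarith) hz0
    have h3 := hone hd₁ hv₁ (by linarith) hz0
    have h4 := hone hd₂ hv₂ (by linarith) hz0
    calc _ ≤ ((1 : ℝ) + 1) * (1 + 1) := by gcongr
      _ = 4 := by norm_num
  have ha : ∀ z ∈ Complex.re ⁻¹' {(1 / 2 : ℝ)}, ‖F z‖ ≤ √2 := by
    intro z hz
    have hz : z.re = 1 / 2 := hz
    have hz0 : 0 < z.re := by rw [hz]; norm_num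
    have hsq : ∀ {e : ℂ} {u : ℝ}, ‖e‖ ≤ 1 → 0 ≤ u → ‖e * (u : ℂ) ^ z‖ ^ 2 ≤ u := by
      intro e u he hu
      have := hmul he hu hz0
      rw [hz, ← Real.sqrt_eq_rpow] at this
      calc _ ≤ (√u) ^ 2 := by gcongr
        _ = u := Real.sq_sqrt hu
    have h1 := hsq he₁ hu₁
    have h2 := hsq he₂ hu₂
    have h3 := hsq hd₁ hv₁
    have h4 := hsq hd₂ hv₂
    show ‖d₁ * (v₁ : ℂ) ^ z * (e₁ * (u₁ : ℂ) ^ z + e₂ * (u₂ : ℂ) ^ z) +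
      d₂ * (v₂ : ℂ) ^ z * (e₁ * (u₁ : ℂ) ^ z - e₂ * (u₂ : ℂ) ^ z)‖ ≤ √2
    generalize e₁ * (u₁ : ℂ) ^ z = P at *
    generalize e₂ * (u₂ : ℂ) ^ z = Q at *
    generalize d₁ * (v₁ : ℂ) ^ z = D at *
    generalize d₂ * (v₂ : ℂ) ^ z = E at *
    apply Real.le_sqrt_of_sq_le
    have hpar := parallelogram_law_with_norm ℝ P Q
    have hnorm : ‖D * (P + Q) + E * (P - Q)‖ ≤ ‖D‖ * ‖P + Q‖ + ‖E‖ * ‖P - Q‖ := by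
      simpa only [norm_mul] using norm_add_le (D * (P + Q)) (E * (P - Q))
    calc _ ≤ (‖D‖ * ‖P + Q‖ + ‖E‖ * ‖P - Q‖) ^ 2 := by gcongr
      _ ≤ (‖D‖ ^ 2 + ‖E‖ ^ 2) * (‖P + Q‖ ^ 2 + ‖P - Q‖ ^ 2) := by
          nlinarith [sq_nonneg (‖D‖ * ‖P - Q‖ - ‖E‖ * ‖P + Q‖)]
      _ ≤ 1 * 2 := by
          gcongr
          · linarith
          · nlinarith
      _ = 2 := by norm_num
  have hb : ∀ z ∈ Complex.re ⁻¹' {(1 : ℝ)}, ‖F z‖ ≤ 1 := by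
    intro z hz
    have hz : z.re = 1 := hz
    have hz0 : 0 < z.re := by rw [hz]; norm_num
    refine (htri _ _ _ _).trans ?_
    have h1 := hmul he₁ hu₁ hz0
    have h2 := hmul he₂ hu₂ hz0
    have h3 := hmul hd₁ hv₁ hz0
    have h4 := hmul hd₂ hv₂ hz0
    rw [hz, Real.rpow_one] at h1 h2 h3 h4
    calc _ ≤ (v₁ + v₂) * (u₁ + u₂) := by gcongr
      _ = 1 := by rw [hu, hv, one_mul]
  have h := Complex.HadamardThreeLines.norm_le_interp_of_mem_verticalClosedStrip'
    (z := (s : ℂ)) (by norm_num) (by simpa [Complex.HadamardThreeLines.verticalClosedStrip] using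
      ⟨by linarith, hs1⟩) hD hB ha hb
  refine h.trans_eq ?_
  rw [Real.one_rpow, mul_one, Real.sqrt_eq_rpow, ← Real.rpow_mul (by norm_num), Complex.ofReal_re]
  congr 1
  ring

theorem exists_norm_le_one_mul_norm_eq (x : ℂ) : ∃ e : ℂ, ‖e‖ ≤ 1 ∧ e * ‖x‖ = x := by
  by_cases hx : x = 0
  · exact ⟨0, by simp, by simp [hx]⟩
  · have : (‖x‖ : ℂ) ≠ 0 := by simpa using hx
    exact ⟨x / ‖x‖, by simp [hx], by field_simp⟩

theorem exists_norm_le_one_mul_eq_norm (x : ℂ) : ∃ d : ℂ, ‖d‖ ≤ 1 ∧ d * x = ‖x‖ := by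
  by_cases hx : x = 0
  · exact ⟨0, by simp, by simp [hx]⟩
  · exact ⟨‖x‖ / x, by simp [hx], by field_simp⟩

/-- The Hausdorff–Young inequality on the group with two elements (Clarkson's inequality). -/
theorem rpow_norm_add_sub_le {q p : ℝ} (hqp : q.HolderConjugate p) (hq2 : q ≤ 2) (x y : ℂ) :
    (‖x + y‖ ^ p + ‖x - y‖ ^ p) ^ (1 / p) ≤
      2 ^ (1 / p) * (‖x‖ ^ q + ‖y‖ ^ q) ^ (1 / q) := by
  have hq := hqp.pos
  have hp := hqp.symm.pos
  have hpq : 1 / p = 1 - 1 / q := by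
    have := hqp.inv_add_inv_eq_one
    simp only [one_div]; linarith
  set S := ‖x + y‖ ^ p + ‖x - y‖ ^ p with hS
  set T := ‖x‖ ^ q + ‖y‖ ^ q with hT
  have hS0 : 0 ≤ S := by positivity
  have hT0 : 0 ≤ T := by positivity
  rcases hS0.eq_or_lt with hS' | hSpos
  · rw [← hS', Real.zero_rpow (by positivity)]; positivity
  rcases hT0.eq_or_lt with hT' | hTpos
  · exfalso
    have hx : ‖x‖ ^ q = 0 := by
      have h1 : 0 ≤ ‖x‖ ^ q := by positivity
      have h2 : 0 ≤ ‖y‖ ^ q := by positivity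
      linarith
    have hy : ‖y‖ ^ q = 0 := by linarith
    rw [Real.rpow_eq_zero (norm_nonneg _) hq.ne', norm_eq_zero] at hx hy
    rw [hS, hx, hy] at hSpos
    simp [Real.zero_rpow hp.ne'] at hSpos
  obtain ⟨e₁, he₁, hx⟩ := exists_norm_le_one_mul_norm_eq x
  obtain ⟨e₂, he₂, hy⟩ := exists_norm_le_one_mul_norm_eq y
  obtain ⟨d₁, hd₁, hw₁⟩ := exists_norm_le_one_mul_eq_norm (x + y)
  obtain ⟨d₂, hd₂, hw₂⟩ := exists_norm_le_one_mul_eq_norm (x - y)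
  have hs1 : 1 / q ≤ 1 := by rw [div_le_one hq]; exact hqp.lt.le
  have hs2 : 1 / 2 ≤ 1 / q := by gcongr
  have key := norm_hadamard_form_le (s := 1 / q) (u₁ := ‖x‖ ^ q / T) (u₂ := ‖y‖ ^ q / T)
    (v₁ := ‖x + y‖ ^ p / S) (v₂ := ‖x - y‖ ^ p / S) hs2 hs1 (by positivity) (by positivity)
    (by positivity) (by positivity) (by rw [← add_div, div_self hTpos.ne'])
    (by rw [← add_div, div_self hSpos.ne']) he₁ he₂ hd₁ hd₂
  have hroot : ∀ a : ℝ, 0 ≤ a → (a ^ q / T) ^ (1 / q) = a / T ^ (1 / q) := by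
    intro a ha
    rw [Real.div_rpow (by positivity) hT0, ← Real.rpow_mul ha, mul_one_div_cancel hq.ne',
      Real.rpow_one]
  have hdual : ∀ a : ℝ, 0 ≤ a → a * (a ^ p / S) ^ (1 / q) = a ^ p / S ^ (1 / q) := by
    intro a ha
    rw [Real.div_rpow (by positivity) hS0, ← Real.rpow_mul ha, mul_div_assoc']
    rcases ha.eq_or_lt with rfl | ha'
    · simp [Real.zero_rpow hp.ne']
    · congr 1
      nth_rewrite 1 [← Real.rpow_one a]
      rw [← Real.rpow_add ha']
      congr 1
      have : p * (1 / p) = 1 := mul_one_div_cancel hp.ne'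
      rw [hpq] at this
      linarith
  simp only [← Complex.ofReal_cpow (show 0 ≤ ‖x‖ ^ q / T by positivity),
    ← Complex.ofReal_cpow (show 0 ≤ ‖y‖ ^ q / T by positivity),
    ← Complex.ofReal_cpow (show 0 ≤ ‖x + y‖ ^ p / S by positivity),
    ← Complex.ofReal_cpow (show 0 ≤ ‖x - y‖ ^ p / S by positivity),
    hroot _ (norm_nonneg _)] at key
  have hTq : 0 < T ^ (1 / q) := by positivity
  have hTq' : ((T ^ (1 / q) : ℝ) : ℂ) ≠ 0 := by exact_mod_cast hTq.ne'
  have hval : ∀ v₁ v₂ : ℂ, d₁ * v₁ * (e₁ * ((‖x‖ / T ^ (1 / q) : ℝ) : ℂ) +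
      e₂ * ((‖y‖ / T ^ (1 / q) : ℝ) : ℂ)) +
      d₂ * v₂ * (e₁ * ((‖x‖ / T ^ (1 / q) : ℝ) : ℂ) - e₂ * ((‖y‖ / T ^ (1 / q) : ℝ) : ℂ)) =
      (‖x + y‖ * v₁ + ‖x - y‖ * v₂) / ((T ^ (1 / q) : ℝ) : ℂ) := by
    intro v₁ v₂
    rw [← hw₁, ← hw₂]
    push_cast only [Complex.ofReal_div]
    rw [mul_div_assoc', mul_div_assoc', hx, hy]
    field_simp
  rw [hval, ← Complex.ofReal_mul, ← Complex.ofReal_mul, hdual _ (norm_nonneg _),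
    hdual _ (norm_nonneg _), ← Complex.ofReal_add, ← Complex.ofReal_div, Complex.norm_real,
    ← add_div, ← hS, Real.norm_of_nonneg (by positivity), div_le_iff₀ hTq] at key
  rw [hpq]
  refine le_trans (le_of_eq ?_) key
  rw [Real.rpow_sub hSpos, Real.rpow_one]

theorem PiLp.norm_fin_two {p : ℝ≥0∞} (hp : 1 ≤ p) (hp' : p ≠ ∞)
    (x : PiLp p (fun _ : Fin 2 => ℂ)) :
    ‖x‖ = (‖x 0‖ ^ p.toReal + ‖x 1‖ ^ p.toReal) ^ (1 / p.toReal) := by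
  rw [PiLp.norm_eq_sum (ENNReal.toReal_pos (zero_lt_one.trans_le hp).ne' hp'), Fin.sum_univ_two]

theorem PiLp.norm_top_le_iff_fin_two (x : PiLp ∞ (fun _ : Fin 2 => ℂ)) (c : ℝ) :
    ‖x‖ ≤ c ↔ ‖x 0‖ ≤ c ∧ ‖x 1‖ ≤ c := by
  rw [PiLp.norm_eq_ciSup, ciSup_le_iff (Set.finite_range _).bddAbove, Fin.forall_fin_two]

theorem Real.le_rpow_add_rpow_left {r a b : ℝ} (hr : 0 < r) (ha : 0 ≤ a) (hb : 0 ≤ b) :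
    a ≤ (a ^ r + b ^ r) ^ (1 / r) := by
  rw [one_div, Real.le_rpow_inv_iff_of_pos ha (by positivity) hr]
  have : 0 ≤ b ^ r := by positivity
  linarith

theorem Real.le_rpow_add_rpow_right {r a b : ℝ} (hr : 0 < r) (ha : 0 ≤ a) (hb : 0 ≤ b) :
    b ≤ (a ^ r + b ^ r) ^ (1 / r) := by
  rw [add_comm]
  exact Real.le_rpow_add_rpow_left hr hb ha

/-- The `ℓ_p` norm on `ℂ²` decreases with the exponent. -/
theorem PiLp.norm_le_norm_of_exponent_le {p q : ℝ≥0∞} (hq : 1 ≤ q) (hqp : q ≤ p) (f : Fin 2 → ℂ) :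
    ‖(WithLp.toLp p f : PiLp p (fun _ : Fin 2 => ℂ))‖ ≤
      ‖(WithLp.toLp q f : PiLp q (fun _ : Fin 2 => ℂ))‖ := by
  by_cases hq' : q = ∞
  · obtain rfl : p = ∞ := by simpa [hq'] using hqp
    subst hq'
    exact le_rfl
  have hq0 : 0 < q.toReal := ENNReal.toReal_pos (zero_lt_one.trans_le hq).ne' hq'
  rw [PiLp.norm_fin_two hq hq']
  by_cases hp' : p = ∞
  · subst hp'
    rw [PiLp.norm_top_le_iff_fin_two]
    exact ⟨Real.le_rpow_add_rpow_left hq0 (norm_nonneg _) (norm_nonneg _),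
      Real.le_rpow_add_rpow_right hq0 (norm_nonneg _) (norm_nonneg _)⟩
  · rw [PiLp.norm_fin_two (hq.trans hqp) hp']
    exact Real.rpow_add_rpow_le (norm_nonneg _) (norm_nonneg _) hq0
      (ENNReal.toReal_mono hp' hqp)

theorem Real.rpow_add_rpow_le_two_rpow_mul {r s a b : ℝ} (ha : 0 ≤ a) (hb : 0 ≤ b) (hr : 0 < r)
    (hrs : r ≤ s) :
    (a ^ r + b ^ r) ^ (1 / r) ≤ 2 ^ (1 / r - 1 / s) * (a ^ s + b ^ s) ^ (1 / s) := by
  have hs : 0 < s := hr.trans_le hrs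
  have h := NNReal.rpow_add_le_mul_rpow_add_rpow ⟨a ^ r, by positivity⟩ ⟨b ^ r, by positivity⟩
    (p := s / r) (by rwa [one_le_div hr])
  have h : (a ^ r + b ^ r) ^ (s / r) ≤ 2 ^ (s / r - 1) * ((a ^ r) ^ (s / r) + (b ^ r) ^ (s / r)) :=
    by exact_mod_cast h
  rw [← Real.rpow_mul ha, ← Real.rpow_mul hb, mul_div_cancel₀ _ hr.ne'] at h
  have h := Real.rpow_le_rpow (by positivity) h (show 0 ≤ 1 / s by positivity)
  rw [Real.mul_rpow (by positivity) (by positivity), ← Real.rpow_mul (by positivity),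
    ← Real.rpow_mul (by positivity)] at h
  convert h using 3 <;> field_simp

/-- Comparison of the `ℓ_q` and `ℓ_p` norms on `ℂ²`, in the direction that costs a constant. -/
theorem PiLp.norm_le_two_rpow_mul_norm {p q : ℝ≥0∞} (hq : 1 ≤ q) (hqp : q ≤ p) (f : Fin 2 → ℂ) :
    ‖(WithLp.toLp q f : PiLp q (fun _ : Fin 2 => ℂ))‖ ≤
      2 ^ ((1 / q).toReal - (1 / p).toReal) *
        ‖(WithLp.toLp p f : PiLp p (fun _ : Fin 2 => ℂ))‖ := by
  by_cases hq' : q = ∞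
  · obtain rfl : p = ∞ := by simpa [hq'] using hqp
    subst hq'
    simp
  have hq0 : 0 < q.toReal := ENNReal.toReal_pos (zero_lt_one.trans_le hq).ne' hq'
  rw [PiLp.norm_fin_two hq hq']
  by_cases hp' : p = ∞
  · subst hp'
    obtain ⟨h0, h1⟩ := (PiLp.norm_top_le_iff_fin_two
      (WithLp.toLp ∞ f : PiLp ∞ (fun _ : Fin 2 => ℂ)) _).1 le_rfl
    set M := ‖(WithLp.toLp ∞ f : PiLp ∞ (fun _ : Fin 2 => ℂ))‖
    have hM : 0 ≤ M := (norm_nonneg _).trans h0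
    calc _ ≤ (M ^ q.toReal + M ^ q.toReal) ^ (1 / q.toReal) := by gcongr
      _ = _ := by
        rw [← two_mul, Real.mul_rpow (by norm_num) (by positivity), ← Real.rpow_mul hM,
          mul_one_div_cancel hq0.ne', Real.rpow_one]
        simp
  · rw [PiLp.norm_fin_two (hq.trans hqp) hp']
    have := Real.rpow_add_rpow_le_two_rpow_mul (norm_nonneg (f 0)) (norm_nonneg (f 1)) hq0
      (ENNReal.toReal_mono hp' hqp)
    simpa using this

/-- Minkowski's inequality for two pairs of nonnegative reals. -/
theorem Real.minkowski_pair {r a b c d : ℝ} (hr : 1 ≤ r) (ha : 0 ≤ a) (hb : 0 ≤ b) (hc : 0 ≤ c)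
    (hd : 0 ≤ d) :
    ((a + c) ^ r + (b + d) ^ r) ^ (1 / r) ≤
      (a ^ r + b ^ r) ^ (1 / r) + (c ^ r + d ^ r) ^ (1 / r) := by
  have := Real.Lp_add_le_of_nonneg (s := Finset.univ) (f := ![a, b]) (g := ![c, d]) hr
    (by simp [Fin.forall_fin_two, ha, hb]) (by simp [Fin.forall_fin_two, hc, hd])
  simpa [Fin.sum_univ_two] using this

/-- The `2`-convexity of `ℓ_p²` for `2 ≤ p`. -/
theorem PiLp.norm_sq_le_add {p : ℝ≥0∞} (hp : 2 ≤ p) (x y z : PiLp p (fun _ : Fin 2 => ℂ))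
    (h : ∀ i, ‖z i‖ ^ 2 ≤ ‖x i‖ ^ 2 + ‖y i‖ ^ 2) : ‖z‖ ^ 2 ≤ ‖x‖ ^ 2 + ‖y‖ ^ 2 := by
  by_cases hp' : p = ∞
  · subst hp'
    obtain ⟨hx0, hx1⟩ := (PiLp.norm_top_le_iff_fin_two x _).1 le_rfl
    obtain ⟨hy0, hy1⟩ := (PiLp.norm_top_le_iff_fin_two y _).1 le_rfl
    rw [← Real.le_sqrt (norm_nonneg _) (by positivity), PiLp.norm_top_le_iff_fin_two]
    constructor
    · apply Real.le_sqrt_of_sq_le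
      calc _ ≤ _ := h 0
        _ ≤ _ := by gcongr
    · apply Real.le_sqrt_of_sq_le
      calc _ ≤ _ := h 1
        _ ≤ _ := by gcongr
  have hp1 : 1 ≤ p := le_trans (by norm_num) hp
  have hp2 : 2 ≤ p.toReal := by simpa using ENNReal.toReal_mono hp' hp
  rw [PiLp.norm_fin_two hp1 hp', PiLp.norm_fin_two hp1 hp', PiLp.norm_fin_two hp1 hp']
  set r := p.toReal
  have hsq : ∀ a b : ℝ, 0 ≤ a → 0 ≤ b → ((a ^ r + b ^ r) ^ (1 / r)) ^ 2 =
      ((a ^ 2) ^ (r / 2) + (b ^ 2) ^ (r / 2)) ^ (1 / (r / 2)) := by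
    intro a b ha hb
    rw [← Real.rpow_natCast, ← Real.rpow_natCast, ← Real.rpow_natCast,
      ← Real.rpow_mul (by positivity), ← Real.rpow_mul ha, ← Real.rpow_mul hb]
    push_cast
    congr 1
    · congr 2 <;> ring
    · field_simp
  rw [hsq _ _ (norm_nonneg _) (norm_nonneg _), hsq _ _ (norm_nonneg _) (norm_nonneg _),
    hsq _ _ (norm_nonneg _) (norm_nonneg _)]
  refine le_trans ?_ (Real.minkowski_pair (r := r / 2) (by linarith) (by positivity)
    (by positivity) (by positivity) (by positivity))
  gcongr
  · exact h 0
  · exact h 1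

/-- The `2`-concavity of `ℓ_q²` for `q ≤ 2`. -/
theorem PiLp.add_le_norm_sq {q : ℝ≥0∞} (hq : 1 ≤ q) (hq2 : q ≤ 2)
    (x y z : PiLp q (fun _ : Fin 2 => ℂ))
    (h : ∀ i, ‖x i‖ ^ 2 + ‖y i‖ ^ 2 ≤ ‖z i‖ ^ 2) : ‖x‖ ^ 2 + ‖y‖ ^ 2 ≤ ‖z‖ ^ 2 := by
  have hq' : q ≠ ∞ := ne_top_of_le_ne_top (by norm_num) hq2
  have hr2 : q.toReal ≤ 2 := by simpa using ENNReal.toReal_mono (by norm_num) hq2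
  have hr0 : 0 < q.toReal := ENNReal.toReal_pos (zero_lt_one.trans_le hq).ne' hq'
  rw [PiLp.norm_fin_two hq hq', PiLp.norm_fin_two hq hq', PiLp.norm_fin_two hq hq']
  set r := q.toReal
  have hsq : ∀ a : ℝ, 0 ≤ a → (a ^ (1 / r)) ^ 2 = a ^ (2 / r) := by
    intro a ha
    rw [← Real.rpow_natCast, ← Real.rpow_mul ha]
    congr 1
    push_cast
    ring
  have hpow : ∀ a : ℝ, 0 ≤ a → (a ^ r) ^ (2 / r) = a ^ 2 := by
    intro a ha
    rw [← Real.rpow_mul ha, mul_div_cancel₀ _ hr0.ne', Real.rpow_ofNat]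
  have hle : ∀ i, (‖x i‖ ^ 2 + ‖y i‖ ^ 2) ^ (1 / (2 / r)) ≤ ‖z i‖ ^ r := by
    intro i
    calc _ ≤ (‖z i‖ ^ 2) ^ (1 / (2 / r)) := by gcongr; exact h i
      _ = _ := by
        rw [← Real.rpow_natCast, ← Real.rpow_mul (norm_nonneg _)]
        congr 1
        push_cast
        field_simp
  have hmink := Real.minkowski_pair (r := 2 / r) (a := ‖x 0‖ ^ r) (b := ‖y 0‖ ^ r)
    (c := ‖x 1‖ ^ r) (d := ‖y 1‖ ^ r) (by rwa [one_le_div hr0]) (by positivity) (by positivity)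
    (by positivity) (by positivity)
  rw [hpow _ (norm_nonneg _), hpow _ (norm_nonneg _), hpow _ (norm_nonneg _),
    hpow _ (norm_nonneg _)] at hmink
  have hmink := hmink.trans (add_le_add (hle 0) (hle 1))
  rw [one_div, Real.rpow_inv_le_iff_of_pos (by positivity) (by positivity) (by positivity)] at hmink
  rwa [hsq _ (by positivity), hsq _ (by positivity), hsq _ (by positivity)]

/-- Two complex numbers can be rotated simultaneously into the right half-plane. -/
theorem exists_norm_one_re_mul_nonneg (z w : ℂ) :
    ∃ e : ℂ, ‖e‖ = 1 ∧ 0 ≤ (e * z).re ∧ 0 ≤ (e * w).re := by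
  obtain ⟨d, hd, hdz⟩ : ∃ d : ℂ, ‖d‖ = 1 ∧ (d * z).re = 0 := by
    by_cases hz : z = 0
    · exact ⟨1, by simp, by simp [hz]⟩
    · refine ⟨Complex.I * ‖z‖ / z, by simp [hz], ?_⟩
      rw [div_mul_cancel₀ _ hz]
      simp
  rcases le_total 0 (d * w).re with h | h
  · exact ⟨d, hd, hdz.ge, h⟩
  · exact ⟨-d, by simpa using hd, by simp [neg_mul, hdz], by rw [neg_mul, Complex.neg_re]; linarith⟩

/-- Some rotation makes both `e * y i` have nonnegative real inner product with `x i`. -/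
theorem exists_norm_one_add_sq_le (x y : Fin 2 → ℂ) :
    ∃ e : ℂ, ‖e‖ = 1 ∧ ∀ i, ‖x i‖ ^ 2 + ‖y i‖ ^ 2 ≤ ‖x i + e * y i‖ ^ 2 ∧
      ‖x i + -e * y i‖ ^ 2 ≤ ‖x i‖ ^ 2 + ‖y i‖ ^ 2 := by
  obtain ⟨e, he, h0, h1⟩ := exists_norm_one_re_mul_nonneg
    (y 0 * (starRingEnd ℂ) (x 0)) (y 1 * (starRingEnd ℂ) (x 1))
  refine ⟨e, he, ?_⟩
  have key : ∀ a b : ℂ, 0 ≤ (e * (b * (starRingEnd ℂ) a)).re →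
      ‖a‖ ^ 2 + ‖b‖ ^ 2 ≤ ‖a + e * b‖ ^ 2 ∧ ‖a + -e * b‖ ^ 2 ≤ ‖a‖ ^ 2 + ‖b‖ ^ 2 := by
    intro a b h
    have h1 : ‖a + e * b‖ ^ 2 = ‖a‖ ^ 2 + ‖e * b‖ ^ 2 + 2 * (e * (b * (starRingEnd ℂ) a)).re := by
      rw [← Complex.normSq_eq_norm_sq, ← Complex.normSq_eq_norm_sq, ← Complex.normSq_eq_norm_sq,
        add_comm a, Complex.normSq_add, mul_assoc]
      ring
    have h2 := parallelogram_law_with_norm ℝ a (e * b)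
    rw [neg_mul, ← sub_eq_add_neg]
    rw [norm_mul, he, one_mul] at h1 h2
    constructor <;> nlinarith
  rw [Fin.forall_fin_two]
  exact ⟨key _ _ h0, key _ _ h1⟩

theorem PiLp.norm_fin_two_unimodular {p : ℝ≥0∞} (hp : 1 ≤ p) {f : Fin 2 → ℂ}
    (hf : ∀ i, ‖f i‖ = 1) :
    ‖(WithLp.toLp p f : PiLp p (fun _ : Fin 2 => ℂ))‖ = 2 ^ (1 / p).toReal := by
  by_cases hp' : p = ∞
  · subst hp'
    simp [PiLp.norm_eq_ciSup, hf]
  · rw [PiLp.norm_fin_two hp hp']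
    simp only [hf, Real.one_rpow]
    norm_num

theorem PiLp.toLp_fin_two_eq {p : ℝ≥0∞} (e : ℂ) :
    (WithLp.toLp p ![1, e] : PiLp p (fun _ : Fin 2 => ℂ)) =
      WithLp.toLp p (Pi.single 0 1) + e • WithLp.toLp p (Pi.single 1 1) := by
  ext i
  fin_cases i <;> simp

section LowerBound

variable {p q : ℝ≥0∞} [Fact (1 ≤ p)] [Fact (1 ≤ q)]
  (A : PiLp q (fun _ : Fin 2 => ℂ) ≃L[ℂ] PiLp p (fun _ : Fin 2 => ℂ))

/-- The lower bound on the distortion coming from the `2`-concavity of `ℓ_q²`. -/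
theorem two_rpow_half_sub_le_norm_mul_norm_symm (hq2 : q ≤ 2) :
    (2 : ℝ) ^ (1 / 2 - (1 / p).toReal) ≤
      ‖(A : PiLp q (fun _ : Fin 2 => ℂ) →L[ℂ] PiLp p (fun _ : Fin 2 => ℂ))‖ *
        ‖(A.symm : PiLp p (fun _ : Fin 2 => ℂ) →L[ℂ] PiLp q (fun _ : Fin 2 => ℂ))‖ := by
  set a := ‖(A : PiLp q (fun _ : Fin 2 => ℂ) →L[ℂ] PiLp p (fun _ : Fin 2 => ℂ))‖
  set b := ‖(A.symm : PiLp p (fun _ : Fin 2 => ℂ) →L[ℂ] PiLp q (fun _ : Fin 2 => ℂ))‖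
  have ha : 0 ≤ a := norm_nonneg _
  have hb : 0 ≤ b := norm_nonneg _
  have hv : ∀ i, 1 ≤ a * ‖A.symm (WithLp.toLp p (Pi.single i 1))‖ := fun i => by
    simpa using (A : PiLp q (fun _ : Fin 2 => ℂ) →L[ℂ] PiLp p (fun _ : Fin 2 => ℂ)).le_opNorm
      (A.symm (WithLp.toLp p (Pi.single i 1)))
  obtain ⟨e, he, h⟩ := exists_norm_one_add_sq_le (A.symm (WithLp.toLp p (Pi.single 0 1)))
    (A.symm (WithLp.toLp p (Pi.single 1 1)))
  have hconc := PiLp.add_le_norm_sq Fact.out hq2 (A.symm (WithLp.toLp p (Pi.single 0 1)))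
    (A.symm (WithLp.toLp p (Pi.single 1 1))) (A.symm (WithLp.toLp p ![1, e])) (fun i => by
      rw [PiLp.toLp_fin_two_eq, map_add, map_smul]
      exact (h i).1)
  have hsum : ‖A.symm (WithLp.toLp p ![1, e])‖ ≤ b * 2 ^ (1 / p).toReal := by
    rw [← PiLp.norm_fin_two_unimodular (p := p) Fact.out (f := ![1, e])
      (by simp [Fin.forall_fin_two, he])]
    exact (A.symm : PiLp p (fun _ : Fin 2 => ℂ) →L[ℂ] PiLp q (fun _ : Fin 2 => ℂ)).le_opNorm _
  rw [Real.rpow_sub (by norm_num), div_le_iff₀ (by positivity), ← Real.sqrt_eq_rpow]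
  apply Real.sqrt_le_iff.2 ⟨by positivity, ?_⟩
  have h0 := pow_le_pow_left₀ zero_le_one (hv 0) 2
  have h1 := pow_le_pow_left₀ zero_le_one (hv 1) 2
  calc (2 : ℝ) ≤ a ^ 2 * (‖A.symm (WithLp.toLp p (Pi.single 0 1))‖ ^ 2 +
        ‖A.symm (WithLp.toLp p (Pi.single 1 1))‖ ^ 2) := by linarith
    _ ≤ a ^ 2 * (b * 2 ^ (1 / p).toReal) ^ 2 := by
        gcongr
        exact hconc.trans (by gcongr)
    _ = _ := by ring

/-- The lower bound on the distortion coming from the `2`-convexity of `ℓ_p²`. -/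
theorem two_rpow_sub_half_le_norm_mul_norm_symm (hp : 2 ≤ p) :
    (2 : ℝ) ^ ((1 / q).toReal - 1 / 2) ≤
      ‖(A : PiLp q (fun _ : Fin 2 => ℂ) →L[ℂ] PiLp p (fun _ : Fin 2 => ℂ))‖ *
        ‖(A.symm : PiLp p (fun _ : Fin 2 => ℂ) →L[ℂ] PiLp q (fun _ : Fin 2 => ℂ))‖ := by
  set a := ‖(A : PiLp q (fun _ : Fin 2 => ℂ) →L[ℂ] PiLp p (fun _ : Fin 2 => ℂ))‖
  set b := ‖(A.symm : PiLp p (fun _ : Fin 2 => ℂ) →L[ℂ] PiLp q (fun _ : Fin 2 => ℂ))‖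
  have ha : 0 ≤ a := norm_nonneg _
  have hb : 0 ≤ b := norm_nonneg _
  have hv : ∀ i, ‖A (WithLp.toLp q (Pi.single i 1))‖ ≤ a := fun i => by
    simpa using (A : PiLp q (fun _ : Fin 2 => ℂ) →L[ℂ] PiLp p (fun _ : Fin 2 => ℂ)).le_opNorm
      (WithLp.toLp q (Pi.single i 1))
  obtain ⟨e, he, h⟩ := exists_norm_one_add_sq_le (A (WithLp.toLp q (Pi.single 0 1)))
    (A (WithLp.toLp q (Pi.single 1 1)))
  have hconv := PiLp.norm_sq_le_add hp (A (WithLp.toLp q (Pi.single 0 1)))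
    (A (WithLp.toLp q (Pi.single 1 1))) (A (WithLp.toLp q ![1, -e])) (fun i => by
      rw [PiLp.toLp_fin_two_eq, map_add, map_smul]
      exact (h i).2)
  have hsum : ‖A (WithLp.toLp q ![1, -e])‖ ≤ √2 * a := by
    refine le_of_sq_le_sq ?_ (by positivity)
    have h0 := pow_le_pow_left₀ (norm_nonneg _) (hv 0) 2
    have h1 := pow_le_pow_left₀ (norm_nonneg _) (hv 1) 2
    rw [mul_pow, Real.sq_sqrt (by norm_num)]
    linarith
  rw [Real.rpow_sub (by norm_num), div_le_iff₀ (by positivity), ← Real.sqrt_eq_rpow,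
    ← PiLp.norm_fin_two_unimodular (p := q) Fact.out (f := ![1, -e])
      (by simp [Fin.forall_fin_two, he])]
  calc _ = ‖A.symm (A (WithLp.toLp q ![1, -e]))‖ := by rw [A.symm_apply_apply]
    _ ≤ b * ‖A (WithLp.toLp q ![1, -e])‖ :=
      (A.symm : PiLp p (fun _ : Fin 2 => ℂ) →L[ℂ] PiLp q (fun _ : Fin 2 => ℂ)).le_opNorm _
    _ ≤ b * (√2 * a) := by gcongr
    _ = _ := by ring

end LowerBound

/-- The map `(x, y) ↦ (x + y, x - y)` from `ℓ_q²` to `ℓ_p²`. -/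
noncomputable def hadamardEquiv (q p : ℝ≥0∞) [Fact (1 ≤ p)] [Fact (1 ≤ q)] :
    PiLp q (fun _ : Fin 2 => ℂ) ≃L[ℂ] PiLp p (fun _ : Fin 2 => ℂ) :=
  LinearEquiv.toContinuousLinearEquiv
    { toFun := fun x => WithLp.toLp p ![x 0 + x 1, x 0 - x 1]
      map_add' := fun x y => by ext i; fin_cases i <;> simp <;> ring
      map_smul' := fun c x => by ext i; fin_cases i <;> simp [mul_add, mul_sub]
      invFun := fun x => WithLp.toLp q ![(x 0 + x 1) / 2, (x 0 - x 1) / 2]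
      left_inv := fun x => by ext i; fin_cases i <;> simp
      right_inv := fun x => by ext i; fin_cases i <;> simp <;> ring }

/-- The Hausdorff–Young inequality for `hadamardEquiv`, endpoint exponents included. -/
theorem PiLp.norm_hadamard_le {q p : ℝ≥0∞} (hq : 1 ≤ q) (hq2 : q ≤ 2) (hqp : q.HolderConjugate p)
    (f : Fin 2 → ℂ) :
    ‖(WithLp.toLp p ![f 0 + f 1, f 0 - f 1] : PiLp p (fun _ : Fin 2 => ℂ))‖ ≤
      2 ^ (1 / p).toReal * ‖(WithLp.toLp q f : PiLp q (fun _ : Fin 2 => ℂ))‖ := by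
  have hq' : q ≠ ∞ := ne_top_of_le_ne_top (by norm_num) hq2
  rcases hq.eq_or_lt with rfl | hq1
  · obtain rfl : p = ∞ := ENNReal.HolderConjugate.unique 1 p ∞
    rw [PiLp.norm_top_le_iff_fin_two, PiLp.norm_fin_two le_rfl (by norm_num)]
    simpa using ⟨norm_add_le (f 0) (f 1), norm_sub_le (f 0) (f 1)⟩
  · have hp' : p ≠ ∞ := ((ENNReal.HolderConjugate.lt_top_iff_one_lt p q).2 hq1).ne
    have hp1 : 1 ≤ p := ENNReal.HolderConjugate.one_le p q
    rw [PiLp.norm_fin_two hq hq', PiLp.norm_fin_two hp1 hp']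
    have := rpow_norm_add_sub_le (ENNReal.HolderConjugate.toReal_of_ne_top hq' hp')
      (by simpa using ENNReal.toReal_mono (by norm_num) hq2) (f 0) (f 1)
    simpa using this

theorem norm_hadamardEquiv_le {p q : ℝ≥0∞} [Fact (1 ≤ p)] [Fact (1 ≤ q)] (hq2 : q ≤ 2)
    (hp : 2 ≤ p) :
    ‖(hadamardEquiv q p : PiLp q (fun _ : Fin 2 => ℂ) →L[ℂ] PiLp p (fun _ : Fin 2 => ℂ))‖ ≤
      2 ^ max (1 - (1 / q).toReal) (1 / p).toReal := by
  have hq : 1 ≤ q := Fact.out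
  have hp1 : 1 ≤ p := Fact.out
  apply ContinuousLinearMap.opNorm_le_bound _ (by positivity)
  intro x
  show ‖(WithLp.toLp p ![x 0 + x 1, x 0 - x 1] : PiLp p (fun _ : Fin 2 => ℂ))‖ ≤ _
  have hconj := ENNReal.HolderConjugate.conjExponent hq
  rcases le_total q.conjExponent p with h | h
  · have hr1 : 1 ≤ q.conjExponent := ENNReal.HolderConjugate.one_le _ q
    have hexp : (1 / q.conjExponent).toReal = 1 - (1 / q).toReal := by
      rw [one_div, one_div, ← ENNReal.HolderConjugate.one_sub_inv q q.conjExponent,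
        ENNReal.toReal_sub_of_le (ENNReal.inv_le_one.2 hq) (by norm_num), ENNReal.toReal_one]
    calc _ ≤ _ := PiLp.norm_le_norm_of_exponent_le hr1 h _
      _ ≤ _ := PiLp.norm_hadamard_le hq hq2 hconj x.ofLp
      _ ≤ _ := by
        rw [hexp]
        gcongr
        · norm_num
        · exact le_max_left _ _
  · have hconj' := (ENNReal.HolderConjugate.conjExponent hp1).symm
    have hr1 : 1 ≤ p.conjExponent := ENNReal.HolderConjugate.one_le _ p
    have hqr : q ≤ p.conjExponent := by
      have hconj_symm := hconj.symm
      rw [← ENNReal.inv_le_inv, ← ENNReal.HolderConjugate.one_sub_inv p p.conjExponent,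
        ← ENNReal.HolderConjugate.one_sub_inv q.conjExponent q]
      exact tsub_le_tsub_left (ENNReal.inv_le_inv.2 h) 1
    have hr2 : p.conjExponent ≤ 2 := by
      rw [← ENNReal.inv_le_inv, ← ENNReal.HolderConjugate.one_sub_inv p p.conjExponent,
        ← ENNReal.one_sub_inv_two]
      exact tsub_le_tsub_left (ENNReal.inv_le_inv.2 hp) 1
    calc _ ≤ _ := PiLp.norm_hadamard_le hr1 hr2 hconj' x.ofLp
      _ ≤ 2 ^ (1 / p).toReal * ‖x‖ := by
        gcongr
        exact PiLp.norm_le_norm_of_exponent_le hq hqr _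
      _ ≤ _ := by
        gcongr
        · norm_num
        · exact le_max_right _ _

theorem PiLp.norm_two_hadamard_inv (f : Fin 2 → ℂ) :
    ‖(WithLp.toLp 2 ![(f 0 + f 1) / 2, (f 0 - f 1) / 2] : PiLp 2 (fun _ : Fin 2 => ℂ))‖ =
      2 ^ (-(1 / 2) : ℝ) * ‖(WithLp.toLp 2 f : PiLp 2 (fun _ : Fin 2 => ℂ))‖ := by
  have hpar := parallelogram_law_with_norm ℝ (f 0) (f 1)
  rw [PiLp.norm_fin_two (by norm_num) (by norm_num), PiLp.norm_fin_two (by norm_num) (by norm_num),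
    Real.rpow_neg (by norm_num), ← Real.inv_rpow (by norm_num), ENNReal.toReal_ofNat,
    ← Real.mul_rpow (by norm_num) (by positivity)]
  congr 1
  simp only [Matrix.cons_val_zero, Matrix.cons_val_one, norm_div,
    Complex.norm_ofNat, Real.rpow_ofNat]
  linarith

theorem norm_hadamardEquiv_symm_le {p q : ℝ≥0∞} [Fact (1 ≤ p)] [Fact (1 ≤ q)] (hq2 : q ≤ 2)
    (hp : 2 ≤ p) :
    ‖((hadamardEquiv q p).symm :
        PiLp p (fun _ : Fin 2 => ℂ) →L[ℂ] PiLp q (fun _ : Fin 2 => ℂ))‖ ≤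
      2 ^ ((1 / q).toReal - (1 / p).toReal - 1 / 2) := by
  apply ContinuousLinearMap.opNorm_le_bound _ (by positivity)
  intro x
  show ‖(WithLp.toLp q ![(x 0 + x 1) / 2, (x 0 - x 1) / 2] : PiLp q (fun _ : Fin 2 => ℂ))‖ ≤ _
  calc _ ≤ _ := PiLp.norm_le_two_rpow_mul_norm Fact.out hq2 _
    _ = _ := by rw [PiLp.norm_two_hadamard_inv x.ofLp]
    _ ≤ 2 ^ ((1 / q).toReal - (1 / 2 : ℝ≥0∞).toReal) * (2 ^ (-(1 / 2) : ℝ) *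
          (2 ^ ((1 / 2 : ℝ≥0∞).toReal - (1 / p).toReal) * ‖x‖)) := by
        gcongr
        exact PiLp.norm_le_two_rpow_mul_norm (by norm_num) hp x.ofLp
    _ = _ := by
        rw [← mul_assoc, ← mul_assoc, ← Real.rpow_add (by norm_num), ← Real.rpow_add (by norm_num)]
        congr 2
        ring

/-- For `1 ≤ q ≤ 2 ≤ p ≤ ∞` and `α = max (1/2 - 1/p) (1/q - 1/2)`, every ℂ-linear
homeomorphism `A : ℓ_q²(ℂ) → ℓ_p²(ℂ)` satisfies `‖A‖ ⬝ ‖A⁻¹‖ ≥ 2 ^ α`; in particular the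
Banach–Mazur distance between `ℓ_p²(ℂ)` and `ℓ_q²(ℂ)` is exactly `2 ^ α`. -/
theorem stmt_8 (p q : ℝ≥0∞) (hq1 : 1 ≤ q) (hq2 : q ≤ 2) (hp : 2 ≤ p) :
    letI : Fact (1 ≤ q) := ⟨hq1⟩
    letI : Fact (1 ≤ p) := ⟨le_trans (by norm_num) hp⟩
    (∀ A : PiLp q (fun _ : Fin 2 => ℂ) ≃L[ℂ] PiLp p (fun _ : Fin 2 => ℂ),
      (2 : ℝ) ^ max (1 / 2 - (1 / p).toReal) ((1 / q).toReal - 1 / 2) ≤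
        ‖(A : PiLp q (fun _ : Fin 2 => ℂ) →L[ℂ] PiLp p (fun _ : Fin 2 => ℂ))‖ *
          ‖(A.symm : PiLp p (fun _ : Fin 2 => ℂ) →L[ℂ] PiLp q (fun _ : Fin 2 => ℂ))‖) ∧
    sInf {d : ℝ | ∃ A : PiLp q (fun _ : Fin 2 => ℂ) ≃L[ℂ] PiLp p (fun _ : Fin 2 => ℂ),
        d = ‖(A : PiLp q (fun _ : Fin 2 => ℂ) →L[ℂ] PiLp p (fun _ : Fin 2 => ℂ))‖ *
          ‖(A.symm : PiLp p (fun _ : Fin 2 => ℂ) →L[ℂ] PiLp q (fun _ : Fin 2 => ℂ))‖} =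
      (2 : ℝ) ^ max (1 / 2 - (1 / p).toReal) ((1 / q).toReal - 1 / 2) := by
  have : Fact (1 ≤ q) := ⟨hq1⟩
  have : Fact (1 ≤ p) := ⟨le_trans (by norm_num) hp⟩
  have hlower : ∀ A : PiLp q (fun _ : Fin 2 => ℂ) ≃L[ℂ] PiLp p (fun _ : Fin 2 => ℂ),
      (2 : ℝ) ^ max (1 / 2 - (1 / p).toReal) ((1 / q).toReal - 1 / 2) ≤
        ‖(A : PiLp q (fun _ : Fin 2 => ℂ) →L[ℂ] PiLp p (fun _ : Fin 2 => ℂ))‖ *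
          ‖(A.symm : PiLp p (fun _ : Fin 2 => ℂ) →L[ℂ] PiLp q (fun _ : Fin 2 => ℂ))‖ := by
    intro A
    rcases max_choice (1 / 2 - (1 / p).toReal) ((1 / q).toReal - 1 / 2) with h | h
    · rw [h]; exact two_rpow_half_sub_le_norm_mul_norm_symm A hq2
    · rw [h]; exact two_rpow_sub_half_le_norm_mul_norm_symm A hp
  refine ⟨hlower, IsLeast.csInf_eq ⟨⟨hadamardEquiv q p, le_antisymm (hlower _) ?_⟩, ?_⟩⟩
  · calc _ ≤ (2 : ℝ) ^ max (1 - (1 / q).toReal) (1 / p).toReal *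
          2 ^ ((1 / q).toReal - (1 / p).toReal - 1 / 2) :=
        mul_le_mul (norm_hadamardEquiv_le hq2 hp) (norm_hadamardEquiv_symm_le hq2 hp)
          (norm_nonneg _) (by positivity)
      _ = _ := by
        rw [← Real.rpow_add (by norm_num), max_add]
        congr 2 <;> ring
  · rintro _ ⟨A, rfl⟩
    exact hlower A
end

section
/- Let b ∈ [0, 1] and let r ∈ [−1, 1] with |r| ≥ 1/2. Then there is no angle γ ∈ [0, 2π) such that, setting x = cos γ and y = cos(γ − 2π/3), the numbers x and y have opposite signs (x·y ≤ 0) and both inequalities 4x² + 4brx + b² > 3 and 4y² + 4bry + b² > 3 hold. -/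
open Real

/-- If `x, z ≥ 0` satisfy `x² - xz + z² = 3/4`, `0 ≤ b ≤ 1` and `r ≥ 1/2`, then the two quadratic
expressions in `x` and `-z` cannot both exceed `3`. -/
lemma not_both_quadratics_gt_three {b r x z : ℝ} (hb0 : 0 ≤ b) (hb1 : b ≤ 1) (hr : 1 / 2 ≤ r)
    (hx : 0 ≤ x) (hz : 0 ≤ z) (hxz : x ^ 2 - x * z + z ^ 2 = 3 / 4)
    (h₁ : 3 < 4 * x ^ 2 + 4 * b * r * x + b ^ 2)
    (h₂ : 3 < 4 * z ^ 2 - 4 * b * r * z + b ^ 2) : False := by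
  have hz_quad : 3 < 4 * z ^ 2 - 2 * b * z + b ^ 2 := by
    nlinarith [mul_nonneg (mul_nonneg hb0 hz) (sub_nonneg.2 hr)]
  have hz_pos : 0 < z := by
    rcases hz.lt_or_eq with h | h
    · exact h
    · subst h; nlinarith
  have hprod : 0 < (x + z) * (4 * (x * z) + b ^ 2 - 3) := by
    nlinarith [mul_pos hz_pos (sub_pos.2 h₁), mul_nonneg hx (sub_pos.2 h₂).le]
  have hxz_gt : 0 < 4 * (x * z) + b ^ 2 - 3 := pos_of_mul_pos_right hprod (by positivity)
  have hdiff : 2 * (z - x) < b := lt_of_pow_lt_pow_left₀ 2 hb0 (by nlinarith)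
  have hfactor : 0 < (b + 2 * x - 2 * z) * (b - 2 * x) := by nlinarith
  have hxb : 0 < b - 2 * x := pos_of_mul_pos_right hfactor (by linarith)
  rcases le_total (4 * z - 2 * b) 0 with h | h
  · nlinarith
  · have hmul : z * (4 * z - 2 * b) ≤ (x + b / 2) * (4 * x) :=
      mul_le_mul (by linarith) (by linarith) h (by positivity)
    nlinarith

/-- The version of `not_both_quadratics_gt_three` for `|r| ≥ 1/2`. -/
lemma not_both_quadratics_gt_three_of_abs {b r x z : ℝ} (hb0 : 0 ≤ b) (hb1 : b ≤ 1)
    (hr : 1 / 2 ≤ |r|) (hx : 0 ≤ x) (hz : 0 ≤ z) (hxz : x ^ 2 - x * z + z ^ 2 = 3 / 4)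
    (h₁ : 3 < 4 * x ^ 2 + 4 * b * r * x + b ^ 2)
    (h₂ : 3 < 4 * z ^ 2 - 4 * b * r * z + b ^ 2) : False := by
  rcases le_abs.1 hr with h | h
  · exact not_both_quadratics_gt_three hb0 hb1 h hx hz hxz h₁ h₂
  · exact not_both_quadratics_gt_three hb0 hb1 h hz hx (by linarith) (by linarith) (by linarith)

lemma cos_sq_add_cos_mul_add_sq (γ : ℝ) :
    cos γ ^ 2 + cos γ * cos (γ - 2 * π / 3) + cos (γ - 2 * π / 3) ^ 2 = 3 / 4 := by
  have hangle : 2 * π / 3 = π - π / 3 := by ring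
  rw [cos_sub, hangle, cos_pi_sub, sin_pi_sub, cos_pi_div_three, sin_pi_div_three]
  have hsqrt : √(3 : ℝ) ^ 2 = 3 := sq_sqrt (by norm_num)
  linear_combination (3 / 4) * sin_sq_add_cos_sq γ + sin γ ^ 2 / 4 * hsqrt

/-- Let `b ∈ [0, 1]` and `r ∈ [-1, 1]` with `|r| ≥ 1/2`. Then there is no `γ ∈ [0, 2π)` such
that `x = cos γ` and `y = cos(γ - 2π/3)` satisfy `x·y ≤ 0`, `4x² + 4brx + b² > 3` and
`4y² + 4bry + b² > 3`. -/
theorem stmt_16 (b r : ℝ) (hb : b ∈ Set.Icc (0 : ℝ) 1) (hr : r ∈ Set.Icc (-1 : ℝ) 1)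
    (hr2 : 1 / 2 ≤ |r|) :
    ¬ ∃ γ ∈ Set.Ico (0 : ℝ) (2 * Real.pi),
      Real.cos γ * Real.cos (γ - 2 * Real.pi / 3) ≤ 0 ∧
      3 < 4 * Real.cos γ ^ 2 + 4 * b * r * Real.cos γ + b ^ 2 ∧
      3 < 4 * Real.cos (γ - 2 * Real.pi / 3) ^ 2 +
            4 * b * r * Real.cos (γ - 2 * Real.pi / 3) + b ^ 2 := by
  rintro ⟨γ, -, hxy, h₁, h₂⟩
  have hrel := cos_sq_add_cos_mul_add_sq γ
  obtain ⟨hb0, hb1⟩ := hb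
  rcases mul_nonpos_iff.1 hxy with ⟨hx, hy⟩ | ⟨hx, hy⟩
  · exact not_both_quadratics_gt_three_of_abs hb0 hb1 hr2 hx (neg_nonneg.2 hy)
      (by linarith) h₁ (by linarith)
  · exact not_both_quadratics_gt_three_of_abs hb0 hb1 hr2 hy (neg_nonneg.2 hx)
      (by linarith) h₂ (by linarith)
end
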